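/- Let (R,m) be a Noetherian local ring, let C be a semidualizing R-module, and suppose R is relative Cohen-Macaulay with respect to an ideal a with ht_R(a) = n. Then C is a dualizing R-module if and only if the C-injective dimension C-id_R H_a^n(R) is finite; furthermore, in this case C-id_R H_a^n(R) = id_R(C) − n = id_R H_a^n(C), where id_R denotes injective dimension. -/

import Mathlib

/-!
Common definitions: semidualizing modules, `C`-injective modules and dimensions,
`G_C`-injective modules, Bass/Auslander classes, relative Cohen-Macaulayness,
Cohen-Macaulay and Gorenstein local rings, trivial extensions, ideal torsion.
-/

noncomputable section

open CategoryTheory TensorProduct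

universe u

variable (R : Type u) [CommRing R]

/-- An `R`-module `M` is `C`-injective if it is isomorphic to `Hom_R(C, I)`
for some injective `R`-module `I`. -/
def IsCInjective (C M : ModuleCat.{u} R) : Prop :=
  ∃ I : ModuleCat.{u} R, Module.Injective R I ∧ Nonempty (M ≃ₗ[R] (C →ₗ[R] I))

/-- `HasCoresDimLE R P n M` : the module `M` admits a coresolution of length at most `n`
by modules satisfying the property `P`. -/
def HasCoresDimLE (P : ModuleCat.{u} R → Prop) : ℕ → ModuleCat.{u} R → Prop
  | 0, M => Subsingleton M ∨ P M
  | n + 1, M => Subsingleton M ∨ ∃ (X : ModuleCat.{u} R) (f : M →ₗ[R] X),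
      P X ∧ Function.Injective f ∧
        HasCoresDimLE P n (ModuleCat.of R (X ⧸ LinearMap.range f))

/-- The coresolution dimension of `M` with respect to the class of modules satisfying `P`,
as an element of `ℕ∞` (`⊤` meaning no finite coresolution exists). -/
def coresDim (P : ModuleCat.{u} R → Prop) (M : ModuleCat.{u} R) : ℕ∞ :=
  sInf {d : ℕ∞ | ∃ n : ℕ, d = n ∧ HasCoresDimLE R P n M}

/-- The `C`-injective dimension of `M`. -/
def cinjDim (C M : ModuleCat.{u} R) : ℕ∞ :=
  coresDim R (IsCInjective R C) M

/-- The injective dimension of `M`. -/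
def injDim (M : ModuleCat.{u} R) : ℕ∞ :=
  coresDim R (fun N => Module.Injective R N) M

/-- A finitely generated `R`-module `C` is semidualizing if the natural map
`R → Hom_R(C,C)` is bijective and `Ext_R^i(C,C) = 0` for all `i ≥ 1`. -/
def IsSemidualizing (C : ModuleCat.{u} R) : Prop :=
  Module.Finite R C ∧ Function.Bijective (LinearMap.lsmul R C) ∧
    ∀ i : ℕ, 1 ≤ i →
      Subsingleton (((Ext R (ModuleCat.{u} R) i).obj (Opposite.op C)).obj C)

/-- A dualizing module is a semidualizing module of finite injective dimension. -/
def IsDualizing (C : ModuleCat.{u} R) : Prop :=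
  IsSemidualizing R C ∧ injDim R C ≠ ⊤

/-- A complete `I_C I`-resolution: an exact complex `Y` (with `d i : Y (i+1) → Y i`)
which stays exact after applying `Hom_R(I, -)` for every `C`-injective `I`, whose terms
in positive degrees are `C`-injective and whose terms in degrees `≤ 0` are injective. -/
structure CompleteICIResolution (C : ModuleCat.{u} R) where
  Y : ℤ → ModuleCat.{u} R
  d : (i : ℤ) → (Y (i + 1) →ₗ[R] Y i)
  exact : ∀ i : ℤ, Function.Exact (d (i + 1)) (d i)
  cinj_pos : ∀ i : ℤ, 0 < i → IsCInjective R C (Y i)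
  inj_nonpos : ∀ i : ℤ, i ≤ 0 → Module.Injective R (Y i)
  homExact : ∀ I : ModuleCat.{u} R, IsCInjective R C I → ∀ i : ℤ,
    Function.Exact (fun f : I →ₗ[R] Y (i + 1 + 1) => (d (i + 1)).comp f)
      (fun f : I →ₗ[R] Y (i + 1) => (d i).comp f)

/-- A module is `G_C`-injective if it is the kernel of the degree-`0` differential of some
complete `I_C I`-resolution. -/
def IsGCInjective (C M : ModuleCat.{u} R) : Prop :=
  ∃ res : CompleteICIResolution R C,
    Nonempty (M ≃ₗ[R] ↥(LinearMap.ker (res.d (-1))))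

/-- The `G_C`-injective dimension of `M`. -/
def gcinjDim (C M : ModuleCat.{u} R) : ℕ∞ :=
  coresDim R (IsGCInjective R C) M

/-- `M` is relative Cohen-Macaulay with respect to `a`: there is exactly one
non-vanishing local cohomology module of `M` with respect to `a`. -/
def IsRelativeCM (a : Ideal R) (M : ModuleCat.{u} R) : Prop :=
  ∃! n : ℕ, Nontrivial ((localCohomology a n).obj M)

/-- `M` is relative Cohen-Macaulay with respect to `a`, with (unique) non-vanishing
local cohomology in degree `n`. -/
def IsRelativeCMAt (a : Ideal R) (n : ℕ) (M : ModuleCat.{u} R) : Prop :=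
  Nontrivial ((localCohomology a n).obj M) ∧
    ∀ i : ℕ, i ≠ n → Subsingleton ((localCohomology a i).obj M)

/-- The cohomological dimension `cd(a, M)`: the largest `i` with `H_a^i(M) ≠ 0`. -/
def lcCohomDim (a : Ideal R) (M : ModuleCat.{u} R) : ℕ :=
  sSup {i : ℕ | Nontrivial ((localCohomology a i).obj M)}

/-- The grade `grade(a, M)`: the least `i` with `H_a^i(M) ≠ 0`. -/
def lcGrade (a : Ideal R) (M : ModuleCat.{u} R) : ℕ :=
  sInf {i : ℕ | Nontrivial ((localCohomology a i).obj M)}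

/-- A Noetherian local ring is Cohen-Macaulay iff `H_m^i(R) = 0` for all `i ≠ dim R`
(Grothendieck's characterization, taken here as the definition). -/
def IsCohenMacaulayLocalRing (S : Type u) [CommRing S] [IsLocalRing S] : Prop :=
  ∀ i : ℕ, (i : WithBot ℕ∞) ≠ ringKrullDim S →
    Subsingleton ((localCohomology (IsLocalRing.maximalIdeal S) i).obj (ModuleCat.of S S))

/-- A local ring is Gorenstein if it has finite injective dimension over itself. -/
def IsGorensteinLocalRing (S : Type u) [CommRing S] : Prop :=
  injDim S (ModuleCat.of S S) ≠ ⊤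

/-- The `a`-torsion submodule `Γ_a(M)` of `M`. -/
def idealTorsion (a : Ideal R) (M : Type u) [AddCommGroup M] [Module R M] :
    Submodule R M :=
  ⨆ n : ℕ, Submodule.torsionBySet R M ((a ^ n : Ideal R) : Set R)

/-- The Krull dimension of a module, `dim_S N = dim (S / ann_S N)`. -/
def moduleKrullDim (S : Type u) [CommRing S] (N : Type u) [AddCommGroup N] [Module S N] :
    WithBot ℕ∞ :=
  ringKrullDim (S ⧸ Module.annihilator S N)

/-- `ht_M(a) = inf { dim_{R_p} M_p  |  p ∈ Supp (M / a M) }`. -/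
def heightWRT (a : Ideal R) (M : Type u) [AddCommGroup M] [Module R M] : WithBot ℕ∞ :=
  ⨅ (p : PrimeSpectrum R) (_ : p ∈ Module.support R (M ⧸ (a • (⊤ : Submodule R M)))),
    moduleKrullDim (Localization.AtPrime p.asIdeal) (LocalizedModule p.asIdeal.primeCompl M)

/-- Membership in the Bass class `B_C(R)`. -/
def MemBassClass (C M : ModuleCat.{u} R) : Prop :=
  (∀ i : ℕ, 1 ≤ i →
      Subsingleton (((Ext R (ModuleCat.{u} R) i).obj (Opposite.op C)).obj M)) ∧
  (∀ i : ℕ, 1 ≤ i →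
      Subsingleton (((Tor (ModuleCat.{u} R) i).obj C).obj (ModuleCat.of R (C →ₗ[R] M)))) ∧
  Function.Bijective
    (TensorProduct.lift ((LinearMap.id : (C →ₗ[R] M) →ₗ[R] (C →ₗ[R] M)).flip))

/-- Membership in the Auslander class `A_C(R)`. -/
def MemAuslanderClass (C M : ModuleCat.{u} R) : Prop :=
  (∀ i : ℕ, 1 ≤ i →
      Subsingleton (((Tor (ModuleCat.{u} R) i).obj C).obj M)) ∧
  (∀ i : ℕ, 1 ≤ i →
      Subsingleton (((Ext R (ModuleCat.{u} R) i).obj (Opposite.op C)).obj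
        (ModuleCat.of R (↥C ⊗[R] ↥M)))) ∧
  Function.Bijective ((TensorProduct.mk R ↥C ↥M).flip)

/-- `HasResDimLE R P n M` : `M` admits a resolution of length at most `n`
by modules satisfying `P`. -/
def HasResDimLE (P : ModuleCat.{u} R → Prop) : ℕ → ModuleCat.{u} R → Prop
  | 0, M => Subsingleton M ∨ P M
  | n + 1, M => Subsingleton M ∨ ∃ (X : ModuleCat.{u} R) (f : X →ₗ[R] M),
      P X ∧ Function.Surjective f ∧
        HasResDimLE P n (ModuleCat.of R ↥(LinearMap.ker f))

/-- The projective dimension of `M`. -/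
def projDim (M : ModuleCat.{u} R) : ℕ∞ :=
  sInf {d : ℕ∞ | ∃ n : ℕ, d = n ∧ HasResDimLE R (fun N => Module.Projective R N) n M}

/-- The first projection of the trivial extension `R ⋉ C`, as a ring homomorphism. -/
def trivExtFst (C : Type u) [AddCommGroup C] [Module R C] [Module Rᵐᵒᵖ C]
    [IsCentralScalar R C] : TrivSqZeroExt R C →+* R where
  toFun := TrivSqZeroExt.fst
  map_one' := TrivSqZeroExt.fst_one (R := R) (M := C)
  map_mul' := TrivSqZeroExt.fst_mul
  map_zero' := TrivSqZeroExt.fst_zero (R := R) (M := C)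
  map_add' := TrivSqZeroExt.fst_add

/-- The ideal `a ⊕ C` of the trivial extension `R ⋉ C`. -/
def trivExtIdeal (a : Ideal R) (C : Type u) [AddCommGroup C] [Module R C] [Module Rᵐᵒᵖ C]
    [IsCentralScalar R C] : Ideal (TrivSqZeroExt R C) :=
  Ideal.comap (trivExtFst R C) a

/-- An `R`-module `M`, viewed as a module over the trivial extension `R ⋉ C` via the
natural surjection `R ⋉ C → R`. -/
def trivExtModuleCat (C : Type u) [AddCommGroup C] [Module R C] [Module Rᵐᵒᵖ C]
    [IsCentralScalar R C] (M : Type u) [AddCommGroup M] [Module R M] :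
    ModuleCat.{u} (TrivSqZeroExt R C) :=
  letI := Module.compHom M (trivExtFst R C)
  ModuleCat.of (TrivSqZeroExt R C) M

end

noncomputable section
universe u
open CategoryTheory
namespace LocCoh

section ExtWrappers

variable (R : Type u) [CommRing R]

/-- `Ext^i_R(X, M)` for unbundled modules. -/
abbrev EExt (X M : Type u) [AddCommGroup X] [Module R X] [AddCommGroup M] [Module R M]
    (i : ℕ) : Type u :=
  Abelian.Ext.{u} (ModuleCat.of R X) (ModuleCat.of R M) i

variable {R}
variable {X Y Z M N P : Type u} [AddCommGroup X] [Module R X] [AddCommGroup Y] [Module R Y]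
  [AddCommGroup Z] [Module R Z] [AddCommGroup M] [Module R M] [AddCommGroup N] [Module R N]
  [AddCommGroup P] [Module R P]

/-- Contravariant functoriality of `Ext`. -/
def pre (f : X →ₗ[R] Y) (M : Type u) [AddCommGroup M] [Module R M] (i : ℕ) :
    EExt R Y M i →ₗ[R] EExt R X M i :=
  (Abelian.Ext.mk₀ (ModuleCat.ofHom f)).precompOfLinear R _ (zero_add i)

/-- Covariant functoriality of `Ext`. -/
def post (X : Type u) [AddCommGroup X] [Module R X] (g : M →ₗ[R] N) (i : ℕ) :
    EExt R X M i →ₗ[R] EExt R X N i :=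
  (Abelian.Ext.mk₀ (ModuleCat.ofHom g)).postcompOfLinear R _ (add_zero i)

lemma pre_apply (f : X →ₗ[R] Y) {i : ℕ} (e : EExt R Y M i) :
    pre f M i e = (Abelian.Ext.mk₀ (ModuleCat.ofHom f)).comp e (zero_add i) := rfl

lemma post_apply (g : M →ₗ[R] N) {i : ℕ} (e : EExt R X M i) :
    post X g i e = e.comp (Abelian.Ext.mk₀ (ModuleCat.ofHom g)) (add_zero i) := rfl

lemma pre_id (i : ℕ) (e : EExt R X M i) : pre LinearMap.id M i e = e := by
  rw [pre_apply]; exact Abelian.Ext.mk₀_id_comp e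

lemma post_id (i : ℕ) (e : EExt R X M i) : post X LinearMap.id i e = e := by
  rw [post_apply]; exact Abelian.Ext.comp_mk₀_id e

lemma pre_pre (f : X →ₗ[R] Y) (g : Y →ₗ[R] Z) (i : ℕ) (e : EExt R Z M i) :
    pre f M i (pre g M i e) = pre (g ∘ₗ f) M i e := by
  simp only [pre_apply, ModuleCat.ofHom_comp, Abelian.Ext.mk₀_comp_mk₀_assoc]

lemma post_post (f : M →ₗ[R] N) (g : N →ₗ[R] P) (i : ℕ) (e : EExt R X M i) :
    post X g i (post X f i e) = post X (g ∘ₗ f) i e := by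
  simp only [post_apply, ModuleCat.ofHom_comp, ← Abelian.Ext.mk₀_comp_mk₀]
  rw [Abelian.Ext.comp_assoc_of_third_deg_zero]

lemma pre_post (f : X →ₗ[R] Y) (g : M →ₗ[R] N) (i : ℕ) (e : EExt R Y M i) :
    pre f N i (post Y g i e) = post X g i (pre f M i e) := by
  simp only [pre_apply, post_apply]
  rw [Abelian.Ext.comp_assoc_of_third_deg_zero]

lemma post_add (f g : M →ₗ[R] N) (i : ℕ) (e : EExt R X M i) :
    post X (f + g) i e = post X f i e + post X g i e := by
  simp only [post_apply, ModuleCat.ofHom_add, Abelian.Ext.mk₀_add, Abelian.Ext.comp_add]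

lemma post_smul (r : R) (g : M →ₗ[R] N) (i : ℕ) (e : EExt R X M i) :
    post X (r • g) i e = r • post X g i e := by
  rw [post_apply, post_apply,
    show ModuleCat.ofHom (r • g) = r • ModuleCat.ofHom g from rfl,
    Abelian.Ext.mk₀_smul, Abelian.Ext.comp_smul]

lemma post_lsmul (r : R) (i : ℕ) (e : EExt R X M i) :
    post X (r • (LinearMap.id : M →ₗ[R] M)) i e = r • e := by
  rw [post_smul, post_id]

lemma pre_lsmul (r : R) (i : ℕ) (e : EExt R X M i) :
    pre (r • (LinearMap.id : X →ₗ[R] X)) M i e = r • e := by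
  rw [pre_apply,
    show ModuleCat.ofHom (r • (LinearMap.id : X →ₗ[R] X)) = r • 𝟙 (ModuleCat.of R X) from rfl,
    Abelian.Ext.mk₀_smul, Abelian.Ext.smul_comp, Abelian.Ext.mk₀_id_comp]

/-- `Ext^0` is `Hom`. -/
def ext0 (X M : Type u) [AddCommGroup X] [Module R X] [AddCommGroup M] [Module R M] :
    EExt R X M 0 ≃ₗ[R] (X →ₗ[R] M) :=
  (Abelian.Ext.linearEquiv₀ (R := R)).trans
    (ModuleCat.homLinearEquiv (S := R) (M := ModuleCat.of R X) (N := ModuleCat.of R M))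

lemma ext0_symm (f : X →ₗ[R] M) :
    (ext0 X M).symm f = Abelian.Ext.mk₀ (ModuleCat.ofHom f) := rfl

lemma pre_ext0 (f : X →ₗ[R] Y) (g : Y →ₗ[R] M) :
    pre f M 0 ((ext0 Y M).symm g) = (ext0 X M).symm (g ∘ₗ f) := by
  rw [ext0_symm, ext0_symm, pre_apply, Abelian.Ext.mk₀_comp_mk₀, ModuleCat.ofHom_comp]

lemma post_ext0 (f : M →ₗ[R] N) (g : X →ₗ[R] M) :
    post X f 0 ((ext0 X M).symm g) = (ext0 X N).symm (f ∘ₗ g) := by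
  rw [ext0_symm, ext0_symm, post_apply, Abelian.Ext.mk₀_comp_mk₀, ModuleCat.ofHom_comp]

section SES

variable {A B D : Type u} [AddCommGroup A] [Module R A] [AddCommGroup B] [Module R B]
  [AddCommGroup D] [Module R D]

/-- Data of a short exact sequence of modules. -/
structure SES (f : A →ₗ[R] B) (g : B →ₗ[R] D) : Prop where
  inj : Function.Injective f
  exact : Function.Exact f g
  surj : Function.Surjective g

variable {f : A →ₗ[R] B} {g : B →ₗ[R] D}

lemma SES.shortExact (h : SES f g) :
    (ModuleCat.shortComplexOfCompEqZero f g h.exact.linearMap_comp_eq_zero).ShortExact :=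
  ModuleCat.shortComplex_shortExact _ h.exact h.inj h.surj

lemma SES.mkQ (f : A →ₗ[R] B) (h : Function.Injective f) : SES f (LinearMap.range f).mkQ :=
  ⟨h, f.exact_map_mkQ_range, Submodule.mkQ_surjective _⟩

lemma SES.submodule (p : Submodule R B) : SES p.subtype p.mkQ :=
  ⟨p.injective_subtype, LinearMap.exact_subtype_mkQ p, Submodule.mkQ_surjective _⟩

lemma SES.ker (g : B →ₗ[R] D) (h : Function.Surjective g) : SES (LinearMap.ker g).subtype g :=
  ⟨Submodule.injective_subtype _, LinearMap.exact_subtype_ker_map g, h⟩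

/-- Connecting map in the second variable. -/
def covδ (h : SES f g) (X : Type u) [AddCommGroup X] [Module R X] (i : ℕ) :
    EExt R X D i →ₗ[R] EExt R X A (i + 1) :=
  Abelian.Ext.postcompOfLinear h.shortExact.extClass R (ModuleCat.of R X) rfl

/-- Connecting map in the first variable. -/
def conδ (h : SES f g) (M : Type u) [AddCommGroup M] [Module R M] (i : ℕ) :
    EExt R A M i →ₗ[R] EExt R D M (i + 1) :=
  Abelian.Ext.precompOfLinear h.shortExact.extClass R (ModuleCat.of R M) (add_comm 1 i)

lemma pre_covδ (h : SES f g) (k : X →ₗ[R] Y) (i : ℕ) (e : EExt R Y D i) :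
    pre k A (i + 1) (covδ h Y i e) = covδ h X i (pre k D i e) := by
  change (Abelian.Ext.mk₀ _).comp (Abelian.Ext.comp e _ rfl) (zero_add _) =
    Abelian.Ext.comp ((Abelian.Ext.mk₀ _).comp e (zero_add _)) _ rfl
  exact (Abelian.Ext.comp_assoc _ _ _ (zero_add i) rfl (by omega)).symm

lemma cov_exact₂ (h : SES f g) (i : ℕ) :
    Function.Exact (post X f i) (post X g i) := by
  intro x
  constructor
  · exact fun hx => Abelian.Ext.covariant_sequence_exact₂ _ h.shortExact x hx
  · rintro ⟨y, rfl⟩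
    rw [post_post, h.exact.linearMap_comp_eq_zero, ← zero_smul R (0 : A →ₗ[R] D), post_smul,
      zero_smul]

lemma cov_exact₃ (h : SES f g) (i : ℕ) :
    Function.Exact (post X g i) (covδ h X i) := by
  intro x
  constructor
  · exact fun hx => Abelian.Ext.covariant_sequence_exact₃ _ h.shortExact x rfl hx
  · rintro ⟨y, rfl⟩
    change Abelian.Ext.comp (Abelian.Ext.comp y (Abelian.Ext.mk₀ _) (add_zero _)) _ rfl = 0
    have := h.shortExact.comp_extClass
    change (Abelian.Ext.mk₀ (ModuleCat.ofHom g)).comp h.shortExact.extClass _ = 0 at this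
    rw [Abelian.Ext.comp_assoc _ _ _ (add_zero i) (zero_add 1) (by omega), this,
      Abelian.Ext.comp_zero]

lemma cov_exact₁ (h : SES f g) (i : ℕ) :
    Function.Exact (covδ h X i) (post X f (i + 1)) := by
  intro x
  constructor
  · intro hx
    exact Abelian.Ext.covariant_sequence_exact₁ _ h.shortExact x hx rfl
  · rintro ⟨y, rfl⟩
    change Abelian.Ext.comp (Abelian.Ext.comp y _ rfl) (Abelian.Ext.mk₀ _) (add_zero _) = 0
    have := h.shortExact.extClass_comp
    change h.shortExact.extClass.comp (Abelian.Ext.mk₀ (ModuleCat.ofHom f)) _ = 0 at this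
    rw [Abelian.Ext.comp_assoc _ _ _ (rfl : i + 1 = i + 1) (add_zero 1) (by omega), this,
      Abelian.Ext.comp_zero]

lemma con_exact₂ (h : SES f g) (i : ℕ) :
    Function.Exact (pre g M i) (pre f M i) := by
  intro x
  constructor
  · exact fun hx => Abelian.Ext.contravariant_sequence_exact₂ h.shortExact _ x hx
  · rintro ⟨y, rfl⟩
    rw [pre_pre, h.exact.linearMap_comp_eq_zero, pre_apply,
      show ModuleCat.ofHom (0 : A →ₗ[R] D) = 0 from rfl, Abelian.Ext.mk₀_zero,
      Abelian.Ext.zero_comp]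

lemma con_exact₁ (h : SES f g) (i : ℕ) (x : EExt R A M i) (hx : conδ h M i x = 0) :
    ∃ y, pre f M i y = x :=
  Abelian.Ext.contravariant_sequence_exact₁ h.shortExact _ x (add_comm 1 i) hx

lemma con_exact₃ (h : SES f g) (i : ℕ) (x : EExt R D M (i + 1)) (hx : pre g M (i + 1) x = 0) :
    ∃ y, conδ h M i y = x :=
  Abelian.Ext.contravariant_sequence_exact₃ h.shortExact _ x hx (add_comm 1 i)

end SES

end ExtWrappers

section LCdef

variable {R : Type u} [CommRing R] (a : Ideal R)

/-- The transition map `R ⧸ a ^ t → R ⧸ a ^ s` for `s ≤ t`. -/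
def powTr {s t : ℕ} (h : s ≤ t) : (R ⧸ a ^ t) →ₗ[R] (R ⧸ a ^ s) :=
  Submodule.factor (Ideal.pow_le_pow_right h)

lemma powTr_mk {s t : ℕ} (h : s ≤ t) (r : R) :
    powTr a h (Submodule.Quotient.mk r) = Submodule.Quotient.mk r := rfl

variable (i : ℕ) (M : Type u) [AddCommGroup M] [Module R M]

/-- The local cohomology module `H^i_a(M)` as a direct limit of `Ext^i(R ⧸ a ^ t, M)`. -/
def LC : Type u :=
  Module.DirectLimit (fun t : ℕ => EExt R (R ⧸ a ^ t) M i) (fun _ _ h => pre (powTr a h) M i)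

instance : AddCommGroup (LC a i M) := Module.DirectLimit.addCommGroup _ _

instance : Module R (LC a i M) := Module.DirectLimit.module _ _

instance : DirectedSystem (fun t : ℕ => EExt R (R ⧸ a ^ t) M i)
    (fun _ _ h => pre (powTr a h) M i) where
  map_self t e := by
    have : powTr a (le_refl t) = LinearMap.id := by
      ext; rfl
    rw [this, pre_id]
  map_map k j i' hkj hji e := by
    rw [pre_pre]
    have : powTr a hkj ∘ₗ powTr a hji = powTr a (hkj.trans hji) := by
      ext; rfl
    rw [this]

variable {M}

/-- The canonical map from a finite stage. -/
def ofLC (t : ℕ) : EExt R (R ⧸ a ^ t) M i →ₗ[R] LC a i M :=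
  Module.DirectLimit.of R ℕ (fun t : ℕ => EExt R (R ⧸ a ^ t) M i)
    (fun _ _ h => pre (powTr a h) M i) t

variable {a i}

lemma ofLC_pre {s t : ℕ} (h : s ≤ t) (e : EExt R (R ⧸ a ^ s) M i) :
    ofLC a i t (pre (powTr a h) M i e) = ofLC a i s e :=
  Module.DirectLimit.of_f (R := R) (f := fun _ _ h => pre (powTr a h) M i)

lemma exists_ofLC (z : LC a i M) : ∃ t e, ofLC a i t e = z :=
  Module.DirectLimit.exists_of z

lemma ofLC_eq_zero {t : ℕ} {e : EExt R (R ⧸ a ^ t) M i} (h : ofLC a i t e = 0) :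
    ∃ (s : ℕ) (hs : t ≤ s), pre (powTr a hs) M i e = 0 :=
  Module.DirectLimit.of.zero_exact h

variable {N P : Type u} [AddCommGroup N] [Module R N] [AddCommGroup P] [Module R P]

variable (a i) in
/-- Functoriality of local cohomology. -/
def LCmap (f : M →ₗ[R] N) : LC a i M →ₗ[R] LC a i N :=
  Module.DirectLimit.map (fun t => post (R ⧸ a ^ t) f i) (by
    intro s t h; ext e; exact (pre_post _ _ _ _).symm)

lemma LCmap_of (f : M →ₗ[R] N) (t : ℕ) (e : EExt R (R ⧸ a ^ t) M i) :
    LCmap a i f (ofLC a i t e) = ofLC a i t (post _ f i e) :=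
  Module.DirectLimit.map_apply_of _ _ _

lemma LCmap_id (z : LC a i M) : LCmap a i LinearMap.id z = z := by
  obtain ⟨t, e, rfl⟩ := exists_ofLC z
  rw [LCmap_of, post_id]

lemma LCmap_comp (f : M →ₗ[R] N) (g : N →ₗ[R] P) (z : LC a i M) :
    LCmap a i (g ∘ₗ f) z = LCmap a i g (LCmap a i f z) := by
  obtain ⟨t, e, rfl⟩ := exists_ofLC z
  rw [LCmap_of, LCmap_of, LCmap_of, post_post]

lemma LCmap_add (f g : M →ₗ[R] N) : LCmap a i (f + g) = LCmap a i f + LCmap a i g := by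
  ext z
  obtain ⟨t, e, rfl⟩ := exists_ofLC z
  rw [LinearMap.add_apply, LCmap_of, LCmap_of, LCmap_of, post_add, map_add]

lemma LCmap_smul (r : R) (g : M →ₗ[R] N) : LCmap a i (r • g) = r • LCmap a i g := by
  ext z
  obtain ⟨t, e, rfl⟩ := exists_ofLC z
  rw [LinearMap.smul_apply, LCmap_of, LCmap_of, post_smul, map_smul]

lemma LCmap_lsmul (r : R) (z : LC a i M) :
    LCmap a i (r • (LinearMap.id : M →ₗ[R] M)) z = r • z := by
  rw [LCmap_smul, LinearMap.smul_apply, LCmap_id]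

/-- Local cohomology of isomorphic modules. -/
def LCcongr (a : Ideal R) (i : ℕ) (e : M ≃ₗ[R] N) : LC a i M ≃ₗ[R] LC a i N :=
  LinearEquiv.ofLinearMap (LCmap a i e.toLinearMap) (LCmap a i e.symm.toLinearMap)
    (by ext z; simp [← LCmap_comp, LCmap_id]) (by ext z; simp [← LCmap_comp, LCmap_id])

lemma LC_torsion (z : LC a i M) : ∃ t : ℕ, ∀ r ∈ a ^ t, r • z = 0 := by
  obtain ⟨t, e, rfl⟩ := exists_ofLC z
  refine ⟨t, fun r hr => ?_⟩
  rw [← map_smul, ← pre_lsmul]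
  have : r • (LinearMap.id : (R ⧸ a ^ t) →ₗ[R] (R ⧸ a ^ t)) = 0 := by
    ext
    simp only [LinearMap.smul_apply, LinearMap.id_apply, LinearMap.comp_apply, LinearMap.zero_apply,
      Submodule.mkQ_apply]
    rw [← Submodule.Quotient.mk_smul, Submodule.Quotient.mk_eq_zero]
    simpa using hr
  rw [this, pre_apply, show ModuleCat.ofHom (0 : (R ⧸ a ^ t) →ₗ[R] (R ⧸ a ^ t)) = 0 from rfl,
    Abelian.Ext.mk₀_zero, Abelian.Ext.zero_comp, map_zero]

section Les

variable {A B D : Type u} [AddCommGroup A] [Module R A] [AddCommGroup B] [Module R B]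
  [AddCommGroup D] [Module R D] {f : A →ₗ[R] B} {g : B →ₗ[R] D}

variable (a i) in
/-- Connecting homomorphism. -/
def LCδ (h : SES f g) : LC a i D →ₗ[R] LC a (i + 1) A :=
  Module.DirectLimit.map (fun t => covδ h (R ⧸ a ^ t) i) (by
    intro s t h'; ext e; exact (pre_covδ _ _ _ _).symm)

lemma LCδ_of (h : SES f g) (t : ℕ) (e : EExt R (R ⧸ a ^ t) D i) :
    LCδ a i h (ofLC a i t e) = ofLC a (i + 1) t (covδ h _ i e) :=
  Module.DirectLimit.map_apply_of _ _ _

variable (a i)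

lemma LC_exact₂ (h : SES f g) : Function.Exact (LCmap a i f) (LCmap a i g) := by
  intro z
  constructor
  · intro hz
    obtain ⟨t, e, rfl⟩ := exists_ofLC z
    rw [LCmap_of] at hz
    obtain ⟨s, hs, hse⟩ := ofLC_eq_zero hz
    rw [pre_post] at hse
    obtain ⟨y, hy⟩ := (cov_exact₂ h i _).1 hse
    exact ⟨ofLC a i s y, by rw [LCmap_of, hy, ofLC_pre]⟩
  · rintro ⟨y, rfl⟩
    rw [← LCmap_comp, h.exact.linearMap_comp_eq_zero, ← zero_smul R (0 : A →ₗ[R] D), LCmap_smul,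
      zero_smul, LinearMap.zero_apply]

lemma LC_exact₃ (h : SES f g) : Function.Exact (LCmap a i g) (LCδ a i h) := by
  intro z
  constructor
  · intro hz
    obtain ⟨t, e, rfl⟩ := exists_ofLC z
    rw [LCδ_of] at hz
    obtain ⟨s, hs, hse⟩ := ofLC_eq_zero hz
    rw [pre_covδ] at hse
    obtain ⟨y, hy⟩ := (cov_exact₃ h i _).1 hse
    exact ⟨ofLC a i s y, by rw [LCmap_of, hy, ofLC_pre]⟩
  · rintro ⟨y, rfl⟩
    obtain ⟨t, e, rfl⟩ := exists_ofLC y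
    rw [LCmap_of, LCδ_of, (cov_exact₃ h i).apply_apply_eq_zero, map_zero]

lemma LC_exact₁ (h : SES f g) : Function.Exact (LCδ a i h) (LCmap a (i + 1) f) := by
  intro z
  constructor
  · intro hz
    obtain ⟨t, e, rfl⟩ := exists_ofLC z
    rw [LCmap_of] at hz
    obtain ⟨s, hs, hse⟩ := ofLC_eq_zero hz
    rw [pre_post] at hse
    obtain ⟨y, hy⟩ := (cov_exact₁ h i _).1 hse
    exact ⟨ofLC a i s y, by rw [LCδ_of, hy, ofLC_pre]⟩
  · rintro ⟨y, rfl⟩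
    obtain ⟨t, e, rfl⟩ := exists_ofLC y
    rw [LCδ_of, LCmap_of, (cov_exact₁ h i).apply_apply_eq_zero, map_zero]

end Les

lemma EExt_injective (X E : Type u) [AddCommGroup X] [Module R X] [AddCommGroup E] [Module R E]
    [Module.Injective R E] (i : ℕ) : Subsingleton (EExt R X E (i + 1)) := by
  have := (Module.injective_iff_injective_object R E).1 inferInstance
  exact ⟨fun x y => by rw [Abelian.Ext.eq_zero_of_injective x, Abelian.Ext.eq_zero_of_injective y]⟩

lemma EExt_projective (P M : Type u) [AddCommGroup P] [Module R P] [AddCommGroup M] [Module R M]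
    [Module.Projective R P] (i : ℕ) : Subsingleton (EExt R P M (i + 1)) := by
  have := (IsProjective.iff_projective (R := R) P).1 inferInstance
  exact ⟨fun x y => by
    rw [Abelian.Ext.eq_zero_of_projective x, Abelian.Ext.eq_zero_of_projective y]⟩

lemma LC_injective (a : Ideal R) (E : Type u) [AddCommGroup E] [Module R E]
    [Module.Injective R E] (i : ℕ) : Subsingleton (LC a (i + 1) E) := by
  have (z : LC a (i + 1) E) : z = 0 := by
    obtain ⟨t, e, rfl⟩ := exists_ofLC z
    have := EExt_injective (R := R) (R ⧸ a ^ t) E i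
    rw [Subsingleton.elim e 0, map_zero]
  exact ⟨fun x y => by rw [this x, this y]⟩

/-- The submodule of `a`-power torsion elements. -/
def Gam (a : Ideal R) (M : Type u) [AddCommGroup M] [Module R M] : Submodule R M where
  carrier := {m | ∃ t : ℕ, ∀ r ∈ a ^ t, r • m = 0}
  zero_mem' := ⟨0, fun r _ => smul_zero r⟩
  add_mem' := by
    rintro x y ⟨s, hs⟩ ⟨t, ht⟩
    refine ⟨max s t, fun r hr => ?_⟩
    rw [smul_add, hs r (Ideal.pow_le_pow_right (le_max_left _ _) hr),
      ht r (Ideal.pow_le_pow_right (le_max_right _ _) hr), add_zero]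
  smul_mem' := by
    rintro c x ⟨s, hs⟩
    exact ⟨s, fun r hr => by rw [smul_comm, hs r hr, smul_zero]⟩

/-- `Hom(R ⧸ I, M)` consists of the elements killed by `I`. -/
def homOfKilled (I : Ideal R) (m : M) (h : ∀ r ∈ I, r • m = 0) : (R ⧸ I) →ₗ[R] M :=
  Submodule.liftQ I (LinearMap.toSpanSingleton R M m) (fun r hr => by
    simpa using h r hr)

lemma homOfKilled_mk (I : Ideal R) (m : M) (h : ∀ r ∈ I, r • m = 0) (r : R) :
    homOfKilled I m h (Submodule.Quotient.mk r) = r • m := rfl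

/-- Evaluation at `1` as a map from `H^0_a(M)` to `M`. -/
def LC0to (a : Ideal R) (M : Type u) [AddCommGroup M] [Module R M] : LC a 0 M →ₗ[R] M :=
  Module.DirectLimit.lift R ℕ (fun t : ℕ => EExt R (R ⧸ a ^ t) M 0)
    (fun _ _ h => pre (powTr a h) M 0)
    (fun t => (LinearMap.applyₗ (Submodule.Quotient.mk 1 : R ⧸ a ^ t)).comp
      (ext0 (R ⧸ a ^ t) M).toLinearMap) (by
    intro s t h e
    obtain ⟨φ, rfl⟩ := (ext0 (R ⧸ a ^ s) M).symm.surjective e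
    rw [pre_ext0]
    simp only [LinearMap.comp_apply, LinearEquiv.coe_coe, LinearEquiv.apply_symm_apply,
      LinearMap.applyₗ_apply_apply, powTr_mk])

lemma LC0to_of (t : ℕ) (φ : (R ⧸ a ^ t) →ₗ[R] M) :
    LC0to a M (ofLC a 0 t ((ext0 _ _).symm φ)) = φ (Submodule.Quotient.mk 1) := by
  refine (Module.DirectLimit.lift_of _ _ _).trans ?_
  simp

lemma LC0to_injective : Function.Injective (LC0to a M) := by
  rw [injective_iff_map_eq_zero]
  intro z hz
  obtain ⟨t, e, rfl⟩ := exists_ofLC z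
  obtain ⟨φ, rfl⟩ := (ext0 (R ⧸ a ^ t) M).symm.surjective e
  rw [LC0to_of] at hz
  have : φ = 0 := by
    ext
    simpa using hz
  rw [this, map_zero, map_zero]

lemma LC0to_range : LinearMap.range (LC0to a M) = Gam a M := by
  ext m
  constructor
  · rintro ⟨z, rfl⟩
    obtain ⟨t, ht⟩ := LC_torsion z
    exact ⟨t, fun r hr => by rw [← map_smul, ht r hr, map_zero]⟩
  · rintro ⟨t, ht⟩
    exact ⟨ofLC a 0 t ((ext0 _ _).symm (homOfKilled _ m ht)), by
      rw [LC0to_of, homOfKilled_mk, one_smul]⟩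

lemma LC0to_map (f : M →ₗ[R] N) (z : LC a 0 M) : LC0to a N (LCmap a 0 f z) = f (LC0to a M z) := by
  obtain ⟨t, e, rfl⟩ := exists_ofLC z
  obtain ⟨φ, rfl⟩ := (ext0 (R ⧸ a ^ t) M).symm.surjective e
  rw [LCmap_of, post_ext0, LC0to_of, LC0to_of]
  rfl

variable (a M) in
/-- `H^0_a(M)` is the `a`-power torsion submodule. -/
def LC0 : LC a 0 M ≃ₗ[R] Gam a M :=
  (LinearEquiv.ofInjective (LC0to a M) LC0to_injective).trans (LinearEquiv.ofEq _ _ LC0to_range)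

/-- Restriction of a linear map to torsion submodules. -/
def Gam.map (a : Ideal R) (f : M →ₗ[R] N) : Gam a M →ₗ[R] Gam a N :=
  f.restrict (by
    rintro m ⟨t, ht⟩
    exact ⟨t, fun r hr => by rw [← map_smul, ht r hr, map_zero]⟩)

lemma Gam.map_coe (f : M →ₗ[R] N) (m : Gam a M) : (Gam.map a f m : N) = f m := rfl

lemma LC0_map (f : M →ₗ[R] N) (z : LC a 0 M) :
    LC0 a N (LCmap a 0 f z) = Gam.map a f (LC0 a M z) :=
  Subtype.ext (LC0to_map f z)

end LCdef

section Bridge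

variable {R : Type u} [CommRing R]

section
variable {X M : ModuleCat.{u} R} (P : ProjectiveResolution X)

lemma extMk_zero_degree_eq_zero (f : P.complex.X 0 ⟶ M) (hf : P.complex.d 1 0 ≫ f = 0)
    (h : P.extMk f 1 rfl hf = 0) : f = 0 := by
  rw [← P.extEquivCohomologyClass.apply_eq_iff_eq,
    P.extEquivCohomologyClass_extMk, P.extEquivCohomologyClass_zero,
    CochainComplex.HomComplex.CohomologyClass.mk_eq_zero_iff,
    CochainComplex.HomComplex.Cocycle.toSingleMk_mem_coboundaries_iff _ _ _ _ _ 1 (by simp)] at h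
  obtain ⟨g, hg⟩ := h
  have hz : Limits.IsZero (P.cochainComplex.X 1) :=
    CochainComplex.isZero_of_isStrictlyLE _ 0 1 (by simp)
  rw [hz.eq_of_src g 0, Limits.comp_zero] at hg
  rw [← cancel_epi (P.cochainComplexXIso (-(0 : ℕ)) 0 rfl).hom, ← hg, Limits.comp_zero]

variable (M) in
/-- A cycle of the `Hom` complex, as a morphism. -/
def cycHom (n : ℕ) : ((P.complex.linearYonedaObj R M).cycles n) →ₗ[R] (P.complex.X n ⟶ M) :=
  ((P.complex.linearYonedaObj R M).iCycles n).hom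

lemma d_cycHom (n : ℕ) (z : (P.complex.linearYonedaObj R M).cycles n) :
    P.complex.d (n + 1) n ≫ cycHom M P n z = 0 :=
  ConcreteCategory.congr_hom ((P.complex.linearYonedaObj R M).iCycles_d n (n + 1)) z

lemma extMk_smul (n : ℕ) (f : P.complex.X n ⟶ M) (hf : P.complex.d (n + 1) n ≫ f = 0) (r : R) :
    P.extMk (r • f) (n + 1) rfl (by rw [Linear.comp_smul, hf, smul_zero]) =
      r • P.extMk f (n + 1) rfl hf := by
  rw [Abelian.Ext.smul_eq_comp_mk₀, P.extMk_comp_mk₀]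
  simp only [Linear.comp_smul, Category.comp_id]

lemma extMk_congr {n : ℕ} {f g : P.complex.X n ⟶ M} (h : f = g)
    (hf : P.complex.d (n + 1) n ≫ f = 0) :
    P.extMk f (n + 1) rfl hf = P.extMk g (n + 1) rfl (h ▸ hf) := by
  subst h; rfl

variable (M) in
/-- The class in the derived category `Ext` of a cycle of the `Hom` complex. -/
def cycExt (n : ℕ) : ((P.complex.linearYonedaObj R M).cycles n) →ₗ[R] Abelian.Ext.{u} X M n where
  toFun z := P.extMk (cycHom M P n z) (n + 1) rfl (d_cycHom P n z)
  map_add' x y := (extMk_congr P (map_add (cycHom M P n) x y) _).trans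
    (P.add_extMk _ _ _ _ (d_cycHom P n x) (d_cycHom P n y)).symm
  map_smul' r x := (extMk_congr P (map_smul (cycHom M P n) r x) _).trans
    (extMk_smul P n _ (d_cycHom P n x) r)

lemma cycExt_apply (n : ℕ) (z : (P.complex.linearYonedaObj R M).cycles n) :
    cycExt M P n z = P.extMk (cycHom M P n z) (n + 1) rfl (d_cycHom P n z) := rfl

lemma exists_cycle (K : CochainComplex (ModuleCat.{u} R) ℕ) (n : ℕ) (x : K.X n)
    (hx : K.d n (n + 1) x = 0) : ∃ z : K.cycles n, K.iCycles n z = x := by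
  let k : ModuleCat.of R R ⟶ K.X n := ModuleCat.ofHom (LinearMap.toSpanSingleton R (K.X n) x)
  have hk : k ≫ K.d n (n + 1) = 0 := by
    ext
    simpa [k] using hx
  refine ⟨K.liftCycles k (n + 1) (by simp) hk (1 : R), ?_⟩
  have := ConcreteCategory.congr_hom (K.liftCycles_i k (n + 1) (by simp) hk) (1 : R)
  refine this.trans ?_
  simp [k]

lemma iCycles_injective (K : CochainComplex (ModuleCat.{u} R) ℕ) (n : ℕ) :
    Function.Injective (K.iCycles n) :=
  (ModuleCat.mono_iff_injective _).1 inferInstance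

lemma iCycles_toCycles (K : CochainComplex (ModuleCat.{u} R) ℕ) (i n : ℕ) (x : K.X i) :
    K.iCycles n (K.toCycles i n x) = K.d i n x :=
  ConcreteCategory.congr_hom (K.toCycles_i i n) x

lemma cycExt_surjective (n : ℕ) : Function.Surjective (cycExt M P n) := by
  intro e
  obtain ⟨f, hf, rfl⟩ := P.extMk_surjective e (n + 1) rfl
  obtain ⟨z, hz⟩ := exists_cycle (P.complex.linearYonedaObj R M) n f hf
  exact ⟨z, extMk_congr P hz (d_cycHom P n z)⟩

lemma cycExt_toCycles (i n : ℕ) (hi : (ComplexShape.up ℕ).prev n = i)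
    (x : (P.complex.linearYonedaObj R M).X i) :
    cycExt M P n ((P.complex.linearYonedaObj R M).toCycles i n x) = 0 := by
  have h1 : cycHom M P n ((P.complex.linearYonedaObj R M).toCycles i n x) =
    P.complex.d n i ≫ (x : P.complex.X i ⟶ M) := iCycles_toCycles _ i n x
  obtain _ | p := n
  · obtain rfl : i = 0 := by rw [← hi]; simp
    refine (extMk_congr P (h1.trans ?_) (d_cycHom P 0 _)).trans (P.extMk_zero _ _)
    rw [P.complex.shape _ _ (by simp)]
    exact Limits.zero_comp
  · obtain rfl : i = p := by rw [← hi]; simp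
    rw [cycExt_apply, P.extMk_eq_zero_iff _ _ _ _ i rfl]
    exact ⟨x, h1.symm⟩

lemma exists_toCycles (i n : ℕ) (hi : (ComplexShape.up ℕ).prev n = i)
    (z : (P.complex.linearYonedaObj R M).cycles n)
    (h : cycExt M P n z = 0) :
    ∃ x, (P.complex.linearYonedaObj R M).toCycles i n x = z := by
  obtain _ | p := n
  · refine ⟨0, ?_⟩
    apply iCycles_injective
    rw [map_zero, map_zero]
    exact (extMk_zero_degree_eq_zero P _ (d_cycHom P 0 z) h).symm
  · obtain rfl : i = p := by rw [← hi]; simp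
    rw [cycExt_apply, P.extMk_eq_zero_iff _ _ _ _ i rfl] at h
    obtain ⟨g, hg⟩ := h
    exact ⟨g, iCycles_injective _ _ ((iCycles_toCycles _ _ _ _).trans hg)⟩

variable (M) in
/-- Comparison from the homology of the `Hom` complex to the derived category `Ext`. -/
def homologyExt (n : ℕ) : (P.complex.linearYonedaObj R M).homology n ⟶
    ModuleCat.of R (Abelian.Ext.{u} X M n) :=
  ((P.complex.linearYonedaObj R M).homologyIsCokernel _ n rfl).desc
    (Limits.CokernelCofork.ofπ (ModuleCat.ofHom (cycExt M P n)) (by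
      ext x
      exact cycExt_toCycles P _ n rfl x))

lemma homologyπ_homologyExt (n : ℕ) :
    (P.complex.linearYonedaObj R M).homologyπ n ≫ homologyExt M P n =
      ModuleCat.ofHom (cycExt M P n) :=
  ((P.complex.linearYonedaObj R M).homologyIsCokernel _ n rfl).fac _
    Limits.WalkingParallelPair.one

lemma homologyExt_bijective (n : ℕ) : Function.Bijective (homologyExt M P n) := by
  have hπ : Function.Surjective ((P.complex.linearYonedaObj R M).homologyπ n) :=
    (ModuleCat.epi_iff_surjective _).1 inferInstance
  have hc (z) : homologyExt M P n ((P.complex.linearYonedaObj R M).homologyπ n z) =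
      cycExt M P n z := ConcreteCategory.congr_hom (homologyπ_homologyExt (M := M) P n) z
  constructor
  · change Function.Injective (homologyExt M P n).hom
    rw [injective_iff_map_eq_zero]
    intro h hh
    obtain ⟨z, rfl⟩ := hπ h
    obtain ⟨x, rfl⟩ := exists_toCycles P _ n rfl z ((hc z).symm.trans hh)
    exact ConcreteCategory.congr_hom
      ((P.complex.linearYonedaObj R M).toCycles_comp_homologyπ _ n) x
  · intro e
    obtain ⟨z, rfl⟩ := cycExt_surjective P n e
    exact ⟨_, hc z⟩

end

section Naturality

variable {X X' : ModuleCat.{u} R} (P : ProjectiveResolution X) (P' : ProjectiveResolution X')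
  {M : ModuleCat.{u} R}

/-- The map on `Hom` complexes induced by a morphism of complexes. -/
def yonMap (φ : P'.complex ⟶ P.complex) (M : ModuleCat.{u} R) :
    P.complex.linearYonedaObj R M ⟶ P'.complex.linearYonedaObj R M :=
  (HomologicalComplex.unopFunctor _ _).map
    ((((linearYoneda R (ModuleCat.{u} R)).obj M).rightOp.mapHomologicalComplex _).map φ).op

lemma homologyExt_naturality (g : X' ⟶ X) (φ : P'.Hom P g) (n : ℕ)
    (h : (P.complex.linearYonedaObj R M).homology n) :
    homologyExt M P' n (HomologicalComplex.homologyMap (yonMap P P' φ.hom M) n h) =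
      (Abelian.Ext.mk₀ g).comp (homologyExt M P n h) (zero_add n) := by
  have hπ : Function.Surjective ((P.complex.linearYonedaObj R M).homologyπ n) :=
    (ModuleCat.epi_iff_surjective _).1 inferInstance
  obtain ⟨z, rfl⟩ := hπ h
  have e1 := ConcreteCategory.congr_hom
    (HomologicalComplex.homologyπ_naturality (yonMap P P' φ.hom M) n) z
  have e2 (z) : homologyExt M P n ((P.complex.linearYonedaObj R M).homologyπ n z) =
      cycExt M P n z := ConcreteCategory.congr_hom (homologyπ_homologyExt (M := M) P n) z
  have e3 (z) : homologyExt M P' n ((P'.complex.linearYonedaObj R M).homologyπ n z) =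
      cycExt M P' n z := ConcreteCategory.congr_hom (homologyπ_homologyExt (M := M) P' n) z
  have e4 := ConcreteCategory.congr_hom
    (HomologicalComplex.cyclesMap_i (yonMap P P' φ.hom M) n) z
  rw [e2]
  refine (congrArg (homologyExt M P' n) e1).trans ?_
  refine (e3 _).trans ?_
  rw [cycExt_apply, cycExt_apply, P.mk₀_comp_extMk _ _ _ _ φ]
  exact extMk_congr _ e4 _

/-- The comparison between the two notions of `Ext`. -/
def oldExtHom (M : ModuleCat.{u} R) (n : ℕ) :
    ((Ext R (ModuleCat.{u} R) n).obj (Opposite.op X)).obj M ⟶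
      ModuleCat.of R (Abelian.Ext.{u} X M n) :=
  (P.isoExt n M).hom ≫ homologyExt M P n

lemma oldExtHom_bijective (n : ℕ) : Function.Bijective (oldExtHom P M n) := by
  have h1 : Function.Bijective (P.isoExt (R := R) n M).hom :=
    (ConcreteCategory.isIso_iff_bijective _).1 inferInstance
  exact (homologyExt_bijective P n).comp h1

lemma unop_square {D : Type*} [Category* D] {L L' H H' : Dᵒᵖ} {K K' : D} {α : L ≅ H}
    {α' : L' ≅ H'} {β : H ≅ Opposite.op K} {β' : H' ≅ Opposite.op K'} {m : L' ⟶ L} {h : H' ⟶ H}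
    {k : K ⟶ K'} (h1 : m ≫ α.hom = α'.hom ≫ h) (h2 : h ≫ β.hom = β'.hom ≫ k.op) :
    m.unop ≫ (α'.unop.symm ≪≫ β'.unop.symm).hom = (α.unop.symm ≪≫ β.unop.symm).hom ≫ k := by
  apply Quiver.Hom.op_inj
  have h3 : α'.inv ≫ m = h ≫ α.inv := by
    rw [Iso.inv_comp_eq, ← Category.assoc, ← h1, Category.assoc, Iso.hom_inv_id, Category.comp_id]
  have h4 : β'.inv ≫ h = k.op ≫ β.inv := by
    rw [Iso.inv_comp_eq, ← Category.assoc, ← h2, Category.assoc, Iso.hom_inv_id, Category.comp_id]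
  change (β'.inv ≫ α'.inv) ≫ m = k.op ≫ β.inv ≫ α.inv
  rw [Category.assoc, h3, ← Category.assoc, h4, Category.assoc]

lemma isoExt_naturality (g : X' ⟶ X) (φ : P'.Hom P g) (n : ℕ) :
    ((Ext R (ModuleCat.{u} R) n).map g.op).app M ≫ (P'.isoExt n M).hom =
      (P.isoExt n M).hom ≫ HomologicalComplex.homologyMap (yonMap P P' φ.hom M) n := by
  have h1 := ProjectiveResolution.isoLeftDerivedObj_hom_naturality g P' P
    φ.hom φ.hom_f_zero_comp_π_f_zero (((linearYoneda R (ModuleCat.{u} R)).obj M).rightOp) n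
  have h2 := HomologicalComplex.homologyOp_hom_naturality (yonMap P P' φ.hom M) n
  exact unop_square h1 h2

end Naturality

end Bridge

section BridgeLC

variable {R : Type u} [CommRing R]

/-- The two models of `Ext` agree. -/
def oldExtEquiv (X M : ModuleCat.{u} R) (n : ℕ) :
    ((Ext R (ModuleCat.{u} R) n).obj (Opposite.op X)).obj M ≃ₗ[R] Abelian.Ext.{u} X M n :=
  LinearEquiv.ofBijective (oldExtHom (projectiveResolution X) M n).hom
    (oldExtHom_bijective (projectiveResolution X) n)

lemma oldExtEquiv_naturality {X X' : ModuleCat.{u} R} (g : X' ⟶ X) (M : ModuleCat.{u} R) (n : ℕ)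
    (e : ((Ext R (ModuleCat.{u} R) n).obj (Opposite.op X)).obj M) :
    oldExtEquiv X' M n (((Ext R (ModuleCat.{u} R) n).map g.op).app M e) =
      (Abelian.Ext.mk₀ g).comp (oldExtEquiv X M n e) (zero_add n) := by
  let P := projectiveResolution X
  let P' := projectiveResolution X'
  let φ : P'.Hom P g := ⟨ProjectiveResolution.lift g _ _, by
    have := ProjectiveResolution.lift_commutes_zero g P' P
    simpa using this⟩
  have h1 := ConcreteCategory.congr_hom (isoExt_naturality (M := M) P P' g φ n) e
  have h2 := homologyExt_naturality (M := M) P P' g φ n ((P.isoExt n M).hom e)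
  exact (congrArg (homologyExt M P' n) h1).trans h2

variable (a : Ideal R) (i : ℕ) (M : ModuleCat.{u} R)

variable {M} in
/-- The universal property of `LC`. -/
def LCdesc {Q : Type u} [AddCommGroup Q] [Module R Q]
    (f : ∀ t : ℕ, EExt R (R ⧸ a ^ t) M i →ₗ[R] Q)
    (hf : ∀ (s t : ℕ) (h : s ≤ t) (e : EExt R (R ⧸ a ^ s) M i),
      f t (pre (powTr a h) M i e) = f s e) : LC a i M →ₗ[R] Q :=
  Module.DirectLimit.lift R ℕ _ _ f hf

lemma LCdesc_of {Q : Type u} [AddCommGroup Q] [Module R Q]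
    (f : ∀ t : ℕ, EExt R (R ⧸ a ^ t) M i →ₗ[R] Q)
    (hf : ∀ (s t : ℕ) (h : s ≤ t) (e : EExt R (R ⧸ a ^ s) M i),
      f t (pre (powTr a h) M i e) = f s e) (t : ℕ) (e : EExt R (R ⧸ a ^ t) M i) :
    LCdesc a i f hf (ofLC a i t e) = f t e :=
  Module.DirectLimit.lift_of _ _ _

/-- The cocone exhibiting `LC` as the colimit defining local cohomology. -/
def lcCocone : Limits.Cocone
    (localCohomology.diagram (localCohomology.idealPowersDiagram a) i ⋙
      (evaluation _ _).obj M) where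
  pt := ModuleCat.of R (LC a i M)
  ι :=
    { app := fun j => ModuleCat.ofHom (ofLC a i j.unop.unop ∘ₗ
        (oldExtEquiv (ModuleCat.of R (R ⧸ a ^ j.unop.unop)) M i).toLinearMap)
      naturality := by
        intro j k f
        ext e
        have hle : j.unop.unop ≤ k.unop.unop := f.unop.unop.down.down
        have := oldExtEquiv_naturality (ModuleCat.ofHom (powTr a hle)) M i e
        exact (congrArg (ofLC a i k.unop.unop) this).trans (ofLC_pre hle _) }

/-- The components of a cocone, in terms of `EExt`. -/
def coconeComp (s : Limits.Cocone
    (localCohomology.diagram (localCohomology.idealPowersDiagram a) i ⋙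
      (evaluation _ _).obj M)) (t : ℕ) : EExt R (R ⧸ a ^ t) M i →ₗ[R] s.pt :=
  (s.ι.app (Opposite.op (Opposite.op t))).hom ∘ₗ
      (oldExtEquiv (ModuleCat.of R (R ⧸ a ^ t)) M i).symm.toLinearMap

lemma coconeComp_apply (s : Limits.Cocone
    (localCohomology.diagram (localCohomology.idealPowersDiagram a) i ⋙
      (evaluation _ _).obj M)) (t : ℕ)
    (e : ((Ext R (ModuleCat.{u} R) i).obj (Opposite.op (ModuleCat.of R (R ⧸ a ^ t)))).obj M) :
    coconeComp a i M s t (oldExtEquiv (ModuleCat.of R (R ⧸ a ^ t)) M i e) =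
      (s.ι.app (Opposite.op (Opposite.op t))).hom e :=
  congrArg (s.ι.app (Opposite.op (Opposite.op t))).hom
    (LinearEquiv.symm_apply_apply (oldExtEquiv _ M i) e)

lemma coconeComp_pre (s : Limits.Cocone
    (localCohomology.diagram (localCohomology.idealPowersDiagram a) i ⋙
      (evaluation _ _).obj M)) (t t' : ℕ) (h : t ≤ t') (e : EExt R (R ⧸ a ^ t) M i) :
    coconeComp a i M s t' (pre (powTr a h) M i e) = coconeComp a i M s t e := by
  obtain ⟨e, rfl⟩ := (oldExtEquiv (ModuleCat.of R (R ⧸ a ^ t)) M i).surjective e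
  have h1 := oldExtEquiv_naturality (ModuleCat.ofHom (powTr a h)) M i e
  have h2 := ConcreteCategory.congr_hom
    (s.w (Quiver.Hom.op (Quiver.Hom.op (homOfLE h)) :
      Opposite.op (Opposite.op t) ⟶ Opposite.op (Opposite.op t'))) e
  rw [coconeComp_apply]
  exact ((congrArg (coconeComp a i M s t') h1).symm.trans (coconeComp_apply a i M s _ _)).trans h2

/-- The map out of `LC` induced by a cocone. -/
def lcDesc (s : Limits.Cocone
    (localCohomology.diagram (localCohomology.idealPowersDiagram a) i ⋙
      (evaluation _ _).obj M)) : LC a i M →ₗ[R] s.pt :=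
  LCdesc a i (coconeComp a i M s) (coconeComp_pre a i M s)

lemma lcDesc_apply (s : Limits.Cocone
    (localCohomology.diagram (localCohomology.idealPowersDiagram a) i ⋙
      (evaluation _ _).obj M)) (t : ℕ)
    (e : ((Ext R (ModuleCat.{u} R) i).obj (Opposite.op (ModuleCat.of R (R ⧸ a ^ t)))).obj M) :
    lcDesc a i M s (ofLC a i t (oldExtEquiv (ModuleCat.of R (R ⧸ a ^ t)) M i e)) =
      (s.ι.app (Opposite.op (Opposite.op t))).hom e :=
  (LCdesc_of a i M _ _ _ _).trans (coconeComp_apply a i M s t e)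

/-- `LC` is the colimit defining local cohomology. -/
def lcIsColimit : Limits.IsColimit (lcCocone a i M) where
  desc s := ModuleCat.ofHom (lcDesc a i M s)
  fac s j := by
    ext e
    exact lcDesc_apply a i M s j.unop.unop e
  uniq s m hm := by
    ext z
    obtain ⟨t, e, rfl⟩ := exists_ofLC (z : LC a i M)
    obtain ⟨e, rfl⟩ := (oldExtEquiv (ModuleCat.of R (R ⧸ a ^ t)) M i).surjective e
    have h1 := ConcreteCategory.congr_hom (hm (Opposite.op (Opposite.op t))) e
    exact h1.trans (lcDesc_apply a i M s t e).symm

/-- Local cohomology as defined in Mathlib is `LC`. -/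
def lcIso : (localCohomology a i).obj M ≅ ModuleCat.of R (LC a i M) :=
  Limits.colimitObjIsoColimitCompEvaluation
    (localCohomology.diagram (localCohomology.idealPowersDiagram a) i) M ≪≫
    (Limits.colimit.isColimit _).coconePointUniqueUpToIso (lcIsColimit a i M)

/-- Local cohomology as defined in Mathlib is `LC`. -/
def lcEquiv (N : Type u) [AddCommGroup N] [Module R N] :
    (localCohomology a i).obj (ModuleCat.of R N) ≃ₗ[R] LC a i N :=
  (lcIso a i (ModuleCat.of R N)).toLinearEquiv

end BridgeLC

section Shift

variable {R : Type u} [CommRing R]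
variable {A B D M N X Y : Type u} [AddCommGroup A] [Module R A] [AddCommGroup B] [Module R B]
  [AddCommGroup D] [Module R D] [AddCommGroup M] [Module R M] [AddCommGroup N] [Module R N]
  [AddCommGroup X] [Module R X] [AddCommGroup Y] [Module R Y]

lemma subsingleton_of_exact {f : A →ₗ[R] B} {g : B →ₗ[R] D} (h : Function.Exact f g)
    (hA : Subsingleton A) (hD : Subsingleton D) : Subsingleton B := by
  have (b : B) : b = 0 := by
    obtain ⟨x, rfl⟩ := (h b).1 (Subsingleton.elim _ _)
    rw [Subsingleton.elim x 0, map_zero]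
  exact ⟨fun x y => by rw [this x, this y]⟩

variable {f : A →ₗ[R] B} {g : B →ₗ[R] D}

lemma cov_sub₁ (h : SES f g) {i : ℕ} (hD : Subsingleton (EExt R X D i))
    (hB : Subsingleton (EExt R X B (i + 1))) : Subsingleton (EExt R X A (i + 1)) :=
  subsingleton_of_exact (cov_exact₁ h i) hD hB

lemma cov_sub₂ (h : SES f g) {i : ℕ} (hA : Subsingleton (EExt R X A i))
    (hD : Subsingleton (EExt R X D i)) : Subsingleton (EExt R X B i) :=
  subsingleton_of_exact (cov_exact₂ h i) hA hD

lemma cov_sub₃ (h : SES f g) {i : ℕ} (hB : Subsingleton (EExt R X B i))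
    (hA : Subsingleton (EExt R X A (i + 1))) : Subsingleton (EExt R X D i) :=
  subsingleton_of_exact (cov_exact₃ h i) hB hA

lemma con_sub₁ (h : SES f g) {i : ℕ} (hB : Subsingleton (EExt R B M i))
    (hD : Subsingleton (EExt R D M (i + 1))) : Subsingleton (EExt R A M i) := by
  have (x : EExt R A M i) : x = 0 := by
    obtain ⟨y, rfl⟩ := con_exact₁ h i x (Subsingleton.elim _ _)
    rw [Subsingleton.elim y 0, map_zero]
  exact ⟨fun x y => by rw [this x, this y]⟩

lemma con_sub₂ (h : SES f g) {i : ℕ} (hA : Subsingleton (EExt R A M i))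
    (hD : Subsingleton (EExt R D M i)) : Subsingleton (EExt R B M i) :=
  subsingleton_of_exact (con_exact₂ h i) hD hA

lemma con_sub₃ (h : SES f g) {i : ℕ} (hA : Subsingleton (EExt R A M i))
    (hB : Subsingleton (EExt R B M (i + 1))) : Subsingleton (EExt R D M (i + 1)) := by
  have (x : EExt R D M (i + 1)) : x = 0 := by
    obtain ⟨y, rfl⟩ := con_exact₃ h i x (Subsingleton.elim _ _)
    rw [Subsingleton.elim y 0, map_zero]
  exact ⟨fun x y => by rw [this x, this y]⟩

variable (a : Ideal R)

lemma LC_sub₁ (h : SES f g) {i : ℕ} (hD : Subsingleton (LC a i D))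
    (hB : Subsingleton (LC a (i + 1) B)) : Subsingleton (LC a (i + 1) A) :=
  subsingleton_of_exact (LC_exact₁ a i h) hD hB

lemma LC_sub₂ (h : SES f g) {i : ℕ} (hA : Subsingleton (LC a i A))
    (hD : Subsingleton (LC a i D)) : Subsingleton (LC a i B) :=
  subsingleton_of_exact (LC_exact₂ a i h) hA hD

lemma LC_sub₃ (h : SES f g) {i : ℕ} (hB : Subsingleton (LC a i B))
    (hA : Subsingleton (LC a (i + 1) A)) : Subsingleton (LC a i D) :=
  subsingleton_of_exact (LC_exact₃ a i h) hB hA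

/-- The connecting map is an isomorphism when the cohomology of the middle term vanishes. -/
def LCδEquiv (h : SES f g) {i : ℕ} (h0 : Subsingleton (LC a i B))
    (h1 : Subsingleton (LC a (i + 1) B)) : LC a i D ≃ₗ[R] LC a (i + 1) A :=
  LinearEquiv.ofBijective (LCδ a i h) <| by
    constructor
    · rw [injective_iff_map_eq_zero]
      intro x hx
      obtain ⟨y, rfl⟩ := (LC_exact₃ a i h x).1 hx
      rw [Subsingleton.elim y 0, map_zero]
    · exact fun x => (LC_exact₁ a i h x).1 (Subsingleton.elim _ _)

lemma LC_subsingleton_of_subsingleton [Subsingleton M] (i : ℕ) : Subsingleton (LC a i M) := by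
  have (z : LC a i M) : z = 0 := by
    rw [← LCmap_id z, Subsingleton.elim (LinearMap.id : M →ₗ[R] M) ((0 : R) • LinearMap.id),
      LCmap_smul,
      zero_smul, LinearMap.zero_apply]
  exact ⟨fun x y => by rw [this x, this y]⟩

lemma LC_congr_sub (e : M ≃ₗ[R] N) {i : ℕ} (h : Subsingleton (LC a i M)) :
    Subsingleton (LC a i N) := (LCcongr a i e).toEquiv.subsingleton_congr.1 h

/-- Functoriality of `Ext` along linear equivalences in the second variable. -/
def EExtCongrRight (X : Type u) [AddCommGroup X] [Module R X] (e : M ≃ₗ[R] N) (i : ℕ) :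
    EExt R X M i ≃ₗ[R] EExt R X N i :=
  LinearEquiv.ofLinearMap (post X e.toLinearMap i) (post X e.symm.toLinearMap i)
    (by ext x; simp [post_post, post_id]) (by ext x; simp [post_post, post_id])

lemma EExt_sub_right (e : M ≃ₗ[R] N) {i : ℕ} (h : Subsingleton (EExt R X M i)) :
    Subsingleton (EExt R X N i) := (EExtCongrRight X e i).toEquiv.subsingleton_congr.1 h

lemma EExt_sub_of_sub_left [Subsingleton X] (i : ℕ) : Subsingleton (EExt R X M i) := by
  have (z : EExt R X M i) : z = 0 := by
    rw [← pre_id i z, Subsingleton.elim (LinearMap.id : X →ₗ[R] X) ((0 : R) • LinearMap.id),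
      pre_lsmul]
    exact zero_smul _ _
  exact ⟨fun x y => by rw [this x, this y]⟩

lemma EExt_sub_of_sub_right [Subsingleton M] (i : ℕ) : Subsingleton (EExt R X M i) := by
  have (z : EExt R X M i) : z = 0 := by
    rw [← post_id i z, Subsingleton.elim (LinearMap.id : M →ₗ[R] M) ((0 : R) • LinearMap.id),
      post_lsmul]
    exact zero_smul _ _
  exact ⟨fun x y => by rw [this x, this y]⟩

lemma EExt_zero_sub : Subsingleton (EExt R X M 0) ↔ Subsingleton (X →ₗ[R] M) :=
  (ext0 X M).toEquiv.subsingleton_congr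

lemma LC_zero_sub : Subsingleton (LC a 0 M) ↔ Gam a M = ⊥ := by
  rw [(LC0 a M).toEquiv.subsingleton_congr, Submodule.subsingleton_iff_eq_bot]

lemma covδ_hom_surj (h : SES f g) (hs : Subsingleton (EExt R X A 1)) (k : X →ₗ[R] D) :
    ∃ l : X →ₗ[R] B, g ∘ₗ l = k := by
  obtain ⟨y, hy⟩ := (cov_exact₃ h 0 ((ext0 X D).symm k)).1 (Subsingleton.elim _ _)
  obtain ⟨l, rfl⟩ := (ext0 X B).symm.surjective y
  rw [post_ext0] at hy
  exact ⟨l, (ext0 X D).symm.injective hy⟩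

lemma EExt_one_sub (h : SES f g) (hB : Subsingleton (EExt R X B 1))
    (hs : ∀ k : X →ₗ[R] D, ∃ l : X →ₗ[R] B, g ∘ₗ l = k) : Subsingleton (EExt R X A 1) := by
  have (x : EExt R X A 1) : x = 0 := by
    obtain ⟨y, rfl⟩ := (cov_exact₁ h 0 x).1 (Subsingleton.elim _ _)
    obtain ⟨k, rfl⟩ := (ext0 X D).symm.surjective y
    obtain ⟨l, rfl⟩ := hs k
    rw [← post_ext0]
    exact (cov_exact₃ h 0 _).2 ⟨_, rfl⟩
  exact ⟨fun x y => by rw [this x, this y]⟩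

end Shift

section Injectives

variable {R : Type u} [CommRing R]
variable {M N E : Type u} [AddCommGroup M] [Module R M] [AddCommGroup N] [Module R N]
  [AddCommGroup E] [Module R E]

variable (R M) in
lemma exists_injective_embedding : ∃ (E : Type u) (_ : AddCommGroup E) (_ : Module R E)
    (f : M →ₗ[R] E), Module.Injective R E ∧ Function.Injective f := by
  let J := Injective.under (ModuleCat.of R M)
  refine ⟨J, inferInstance, inferInstance, (Injective.ι (ModuleCat.of R M)).hom, ?_, ?_⟩
  · exact (Module.injective_iff_injective_object R J).2 (inferInstanceAs (Injective J))
  · exact (ModuleCat.mono_iff_injective _).1 inferInstance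

lemma injective_of_retract [Module.Injective R E] (s : M →ₗ[R] E) (r : E →ₗ[R] M)
    (h : r ∘ₗ s = LinearMap.id) : Module.Injective R M where
  out X Y _ _ _ _ f hf g := by
    obtain ⟨k, hk⟩ := Module.Injective.out f hf (s ∘ₗ g)
    refine ⟨r ∘ₗ k, fun x => ?_⟩
    rw [LinearMap.comp_apply, hk]
    exact LinearMap.congr_fun h (g x)

lemma injective_of_equiv [Module.Injective R E] (e : M ≃ₗ[R] E) : Module.Injective R M :=
  injective_of_retract e.toLinearMap e.symm.toLinearMap (by ext; simp)

/-- Every element is killed by a power of `a`. -/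
def IsTors (a : Ideal R) (M : Type u) [AddCommGroup M] [Module R M] : Prop :=
  ∀ x : M, ∃ t : ℕ, ∀ r ∈ a ^ t, r • x = 0

variable {a : Ideal R}

lemma isTors_iff : IsTors a M ↔ Gam a M = ⊤ := by
  rw [Submodule.eq_top_iff']; rfl

lemma isTors_Gam : IsTors a (Gam a M) := fun x => by
  obtain ⟨t, ht⟩ := x.2
  exact ⟨t, fun r hr => Subtype.ext (ht r hr)⟩

lemma isTors_LC (i : ℕ) : IsTors a (LC a i M) := fun z => LC_torsion z

lemma IsTors.of_surjective (h : IsTors a M) (f : M →ₗ[R] N) (hf : Function.Surjective f) :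
    IsTors a N := fun y => by
  obtain ⟨x, rfl⟩ := hf y
  obtain ⟨t, ht⟩ := h x
  exact ⟨t, fun r hr => by rw [← map_smul, ht r hr, map_zero]⟩

lemma IsTors.of_injective (h : IsTors a N) (f : M →ₗ[R] N) (hf : Function.Injective f) :
    IsTors a M := fun y => by
  obtain ⟨t, ht⟩ := h (f y)
  exact ⟨t, fun r hr => hf (by rw [map_smul, ht r hr, map_zero])⟩

lemma IsTors.exists_of_fg [Module.Finite R M] (h : IsTors a M) :
    ∃ t : ℕ, ∀ r ∈ a ^ t, ∀ x : M, r • x = 0 := by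
  obtain ⟨S, hS⟩ := (Module.finite_def (R := R) (M := M)).1 inferInstance
  choose t ht using h
  refine ⟨S.sup t, fun r hr x => ?_⟩
  have hx : x ∈ Submodule.span R (S : Set M) := hS ▸ Submodule.mem_top
  induction hx using Submodule.span_induction with
  | mem x hx => exact ht x r (Ideal.pow_le_pow_right (Finset.le_sup hx) hr)
  | zero => exact smul_zero r
  | add x y _ _ hx hy => rw [smul_add, hx, hy, add_zero]
  | smul c x _ hx => rw [smul_comm, hx, smul_zero]

variable [IsNoetherianRing R]

instance injective_Gam [Module.Injective R E] : Module.Injective R (Gam a E) := by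
  refine Module.Baer.iff_injective.1 fun I g => ?_
  obtain ⟨t, ht⟩ : ∃ t : ℕ, ∀ r ∈ a ^ t, ∀ x : I, r • g x = 0 := by
    obtain ⟨t, ht⟩ := (isTors_Gam (a := a).of_injective (LinearMap.range g).subtype
      (Submodule.injective_subtype _)).exists_of_fg
    exact ⟨t, fun r hr x => congrArg Subtype.val (ht r hr ⟨g x, x, rfl⟩)⟩
  obtain ⟨k, hk⟩ := Ideal.exists_pow_inf_eq_pow_smul (I := a) (M := R) I
  let j : I →ₗ[R] R ⧸ a ^ (k + t) := (Submodule.mkQ (a ^ (k + t))).comp I.subtype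
  have hker : LinearMap.ker j ≤ LinearMap.ker g := by
    intro x hx
    have hx1 : (x : R) ∈ a ^ (k + t) := (Submodule.Quotient.mk_eq_zero _).1 hx
    have h1 := hk (k + t) (Nat.le_add_right _ _)
    have hx2 : (x : R) ∈ a ^ t • I := by
      have : (x : R) ∈ (a ^ (k + t) • ⊤ ⊓ I : Submodule R R) :=
        ⟨by simpa using hx1, x.2⟩
      rw [h1, Nat.add_sub_cancel_left] at this
      exact Submodule.smul_mono le_rfl inf_le_right this
    have key : ∀ y (hy : y ∈ a ^ t • I), ∀ hyI : y ∈ I, g ⟨y, hyI⟩ = 0 := by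
      intro y hy
      induction hy using Submodule.smul_induction_on' with
      | smul r hr n hn =>
        intro hyI
        have : (⟨r • n, hyI⟩ : I) = r • ⟨n, hn⟩ := rfl
        rw [this, map_smul, ht r hr]
      | add y hy z hz h1 h2 =>
        intro hyI
        have h1' := h1 (Submodule.smul_le_right hy)
        have h2' := h2 (Submodule.smul_le_right hz)
        have : (⟨y + z, hyI⟩ : I) = ⟨y, Submodule.smul_le_right hy⟩ +
          ⟨z, Submodule.smul_le_right hz⟩ := rfl
        rw [this, map_add, h1', h2', add_zero]
    exact key x hx2 x.2
  obtain ⟨h, hh⟩ := Module.Injective.out (R := R) (Q := E) ((LinearMap.ker j).liftQ j le_rfl)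
    (LinearMap.ker_eq_bot.1 (Submodule.ker_liftQ_eq_bot _ _ _ le_rfl))
    ((Gam a E).subtype ∘ₗ (LinearMap.ker j).liftQ g hker)
  let φ : R →ₗ[R] Gam a E := ((h ∘ₗ Submodule.mkQ (a ^ (k + t))).codRestrict (Gam a E) (fun x => by
    refine ⟨k + t, fun r hr => ?_⟩
    rw [← map_smul]
    have : (Submodule.mkQ (a ^ (k + t))) (r • x) = 0 :=
      (Submodule.Quotient.mk_eq_zero _).2 (Ideal.mul_mem_right _ _ hr)
    rw [LinearMap.comp_apply, this, map_zero]))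
  refine ⟨φ, fun x hx => Subtype.ext ?_⟩
  exact hh (Submodule.Quotient.mk ⟨x, hx⟩)

lemma exists_torsion_injective_embedding (hM : IsTors a M) :
    ∃ (E : Type u) (_ : AddCommGroup E) (_ : Module R E)
    (f : M →ₗ[R] E), Module.Injective R E ∧ IsTors a E ∧ Function.Injective f := by
  obtain ⟨E, _, _, f, hE, hf⟩ := exists_injective_embedding R M
  refine ⟨Gam a E, inferInstance, inferInstance, f.codRestrict (Gam a E) (fun x => ?_),
    inferInstance, isTors_Gam, fun x y hxy => hf (congrArg Subtype.val hxy)⟩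
  obtain ⟨t, ht⟩ := hM x
  exact ⟨t, fun r hr => by rw [← map_smul, ht r hr, map_zero]⟩

lemma exists_torsionfree_injective_embedding (hM : Gam a M = ⊥) :
    ∃ (E : Type u) (_ : AddCommGroup E) (_ : Module R E)
    (f : M →ₗ[R] E), Module.Injective R E ∧ Gam a E = ⊥ ∧ Function.Injective f := by
  obtain ⟨E, _, _, f, hE, hf⟩ := exists_injective_embedding R M
  obtain ⟨ρ, hρ⟩ := Module.Injective.out (R := R) (Gam a E).subtype
    (Submodule.injective_subtype _) (LinearMap.id : Gam a E →ₗ[R] Gam a E)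
  have hρ' (x : E) : ρ (x - ρ x) = 0 := by
    have := hρ (ρ x)
    rw [map_sub, sub_eq_zero]; exact this.symm
  let p : E →ₗ[R] LinearMap.ker ρ :=
    (LinearMap.id - (Gam a E).subtype ∘ₗ ρ).codRestrict _ (fun x => hρ' x)
  refine ⟨LinearMap.ker ρ, inferInstance, inferInstance, p ∘ₗ f, ?_, ?_, ?_⟩
  · refine injective_of_retract (LinearMap.ker ρ).subtype p ?_
    ext ⟨x, hx⟩
    have : ρ x = 0 := hx
    change x - (ρ x : E) = x
    rw [this]
    simp
  · rw [eq_bot_iff]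
    rintro ⟨x, hx⟩ ⟨t, ht⟩
    have hxΓ : x ∈ Gam a E := ⟨t, fun r hr => congrArg Subtype.val (ht r hr)⟩
    have h1 := hρ ⟨x, hxΓ⟩
    have h2 : ρ x = 0 := hx
    have h3 : (⟨x, hxΓ⟩ : Gam a E) = 0 := h1.symm.trans h2
    exact (Submodule.mem_bot R).2 (Subtype.ext (Subtype.ext_iff.1 h3 : x = 0))
  · rw [injective_iff_map_eq_zero]
    intro m hm
    have h1 : f m - ρ (f m) = 0 := congrArg Subtype.val hm
    have h2 : f m ∈ Gam a E := by rw [sub_eq_zero.1 h1]; exact (ρ (f m)).2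
    obtain ⟨t, ht⟩ := h2
    have : m ∈ Gam a M := ⟨t, fun r hr => hf (by rw [map_smul, ht r hr, map_zero])⟩
    rwa [hM] at this

lemma LC_sub_of_isTors (i : ℕ) : ∀ {M : Type u} [AddCommGroup M] [Module R M],
    IsTors a M → Subsingleton (LC a (i + 1) M) := by
  induction i with
  | zero =>
    intro M _ _ hM
    obtain ⟨E, _, _, f, hE, hT, hf⟩ := exists_torsion_injective_embedding hM
    have h := SES.mkQ f hf
    have := LC_injective a E 0
    have (x : LC a (0 + 1) M) : x = 0 := by
      obtain ⟨y, rfl⟩ := (LC_exact₁ a 0 h x).1 (Subsingleton.elim _ _)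
      obtain ⟨z, hz⟩ := h.surj (LC0 a _ y : E ⧸ LinearMap.range f)
      have hy : y = LCmap a 0 (LinearMap.range f).mkQ ((LC0 a E).symm ⟨z, hT z⟩) := by
        apply (LC0 a _).injective
        rw [LC0_map, LinearEquiv.apply_symm_apply]
        exact Subtype.ext hz.symm
      rw [hy]
      exact (LC_exact₃ a 0 h _).2 ⟨_, rfl⟩
    exact ⟨fun x y => by rw [this x, this y]⟩
  | succ i ih =>
    intro M _ _ hM
    obtain ⟨E, _, _, f, hE, hT, hf⟩ := exists_torsion_injective_embedding hM
    have h := SES.mkQ f hf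
    exact LC_sub₁ a h (ih (hT.of_surjective _ h.surj)) (LC_injective a E _)

lemma Gam_quotient (M : Type u) [AddCommGroup M] [Module R M] : Gam a (M ⧸ Gam a M) = ⊥ := by
  rw [eq_bot_iff]
  intro x ⟨t, ht⟩
  obtain ⟨m, rfl⟩ := Submodule.mkQ_surjective _ x
  have h1 : ∀ r ∈ a ^ t, r • m ∈ Gam a M := fun r hr =>
    (Submodule.Quotient.mk_eq_zero _).1 (ht r hr)
  let p : Submodule R M := Submodule.map (LinearMap.toSpanSingleton R M m) (a ^ t)
  have hp : p ≤ Gam a M := by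
    rintro _ ⟨r, hr, rfl⟩
    exact h1 r hr
  have : Module.Finite R p := Module.Finite.iff_fg.2 ((IsNoetherian.noetherian (a ^ t)).map _)
  obtain ⟨s, hs⟩ := (isTors_Gam.of_injective (Submodule.inclusion hp)
    (Submodule.inclusion_injective hp)).exists_of_fg
  rw [Submodule.mem_bot, Submodule.mkQ_apply, Submodule.Quotient.mk_eq_zero]
  refine ⟨s + t, ?_⟩
  have : a ^ (s + t) ≤ LinearMap.ker (LinearMap.toSpanSingleton R M m) := by
    rw [pow_add, Ideal.mul_le]
    intro r hr q hq
    have := congrArg Subtype.val (hs r hr ⟨q • m, q, hq, rfl⟩)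
    rw [LinearMap.mem_ker, LinearMap.toSpanSingleton_apply, mul_smul]
    exact this
  exact fun r hr => this hr

/-- Killing torsion does not change the higher local cohomology. -/
def LCmodGam (a : Ideal R) (M : Type u) [AddCommGroup M] [Module R M] (i : ℕ) :
    LC a (i + 1) M ≃ₗ[R] LC a (i + 1) (M ⧸ Gam a M) :=
  LinearEquiv.ofBijective (LCmap a (i + 1) (Gam a M).mkQ) <| by
    have h := SES.submodule (Gam a M)
    have h1 : Subsingleton (LC a (i + 1) (Gam a M)) := LC_sub_of_isTors i isTors_Gam
    have h2 : Subsingleton (LC a (i + 1 + 1) (Gam a M)) := LC_sub_of_isTors _ isTors_Gam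
    constructor
    · rw [injective_iff_map_eq_zero]
      intro x hx
      obtain ⟨y, rfl⟩ := (LC_exact₂ a (i + 1) h x).1 hx
      rw [Subsingleton.elim y 0, map_zero]
    · exact fun x => (LC_exact₃ a (i + 1) h x).1 (Subsingleton.elim _ _)

end Injectives

section InjDim

variable {R : Type u} [CommRing R]
variable {A B D M N X : Type u} [AddCommGroup A] [Module R A] [AddCommGroup B] [Module R B]
  [AddCommGroup D] [Module R D] [AddCommGroup M] [Module R M] [AddCommGroup N] [Module R N]
  [AddCommGroup X] [Module R X]
  {f : A →ₗ[R] B} {g : B →ₗ[R] D}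

/-- Injective dimension at most `s`, expressed by vanishing of `Ext`. -/
def IdLE (R : Type u) [CommRing R] (s : ℕ) (M : Type u) [AddCommGroup M] [Module R M] : Prop :=
  ∀ (X : Type u) [AddCommGroup X] [Module R X] (i : ℕ), s < i → Subsingleton (EExt R X M i)

lemma IdLE.congr {s : ℕ} (h : IdLE R s M) (e : M ≃ₗ[R] N) : IdLE R s N :=
  fun X _ _ i hi => EExt_sub_right e (h X i hi)

lemma idLE_of_subsingleton [Subsingleton M] (s : ℕ) : IdLE R s M :=
  fun _ _ _ i _ => EExt_sub_of_sub_right i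

lemma idLE_of_injective [Module.Injective R M] (s : ℕ) : IdLE R s M := fun X _ _ i hi => by
  obtain ⟨j, rfl⟩ := Nat.exists_eq_add_one_of_ne_zero (Nat.ne_zero_of_lt hi)
  exact EExt_injective X M j

lemma injective_of_ext_one (h : SES f g) [Module.Injective R B]
    (hs : Subsingleton (EExt R D A 1)) : Module.Injective R A := by
  obtain ⟨y, hy⟩ := con_exact₁ h 0 ((ext0 A A).symm LinearMap.id) (Subsingleton.elim _ _)
  obtain ⟨r, rfl⟩ := (ext0 B A).symm.surjective y
  rw [pre_ext0] at hy
  exact injective_of_retract f r ((ext0 A A).symm.injective hy)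

lemma idLE_zero_iff : IdLE R 0 M ↔ Module.Injective R M := by
  refine ⟨fun h => ?_, fun h => idLE_of_injective 0⟩
  obtain ⟨E, _, _, f, hE, hf⟩ := exists_injective_embedding R M
  exact injective_of_ext_one (SES.mkQ f hf) (h _ 1 one_pos)

lemma idLE_succ_iff (h : SES f g) [Module.Injective R B] {s : ℕ} :
    IdLE R (s + 1) A ↔ IdLE R s D := by
  refine ⟨fun hA X _ _ i hi => ?_, fun hD X _ _ i hi => ?_⟩
  · exact cov_sub₃ h (idLE_of_injective s X i hi) (hA X (i + 1) (by omega))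
  · obtain ⟨j, rfl⟩ := Nat.exists_eq_add_one_of_ne_zero (Nat.ne_zero_of_lt hi)
    exact cov_sub₁ h (hD X j (by omega)) (EExt_injective X B j)

lemma idLE_of_cyclic {s : ℕ} (h : ∀ I : Ideal R, Subsingleton (EExt R (R ⧸ I) M (s + 1))) :
    IdLE R s M := by
  induction s generalizing M with
  | zero =>
    refine idLE_zero_iff.2 (Module.Baer.iff_injective.1 fun I k => ?_)
    have := h I
    obtain ⟨y, hy⟩ := con_exact₁ (SES.submodule I) 0 ((ext0 I M).symm k) (Subsingleton.elim _ _)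
    obtain ⟨r, rfl⟩ := (ext0 R M).symm.surjective y
    rw [pre_ext0] at hy
    exact ⟨r, fun x hx => LinearMap.congr_fun ((ext0 I M).symm.injective hy) ⟨x, hx⟩⟩
  | succ s ih =>
    obtain ⟨E, _, _, f, hE, hf⟩ := exists_injective_embedding R M
    exact (idLE_succ_iff (SES.mkQ f hf)).2 (ih fun I =>
      cov_sub₃ (SES.mkQ f hf) (EExt_injective _ E s) (h I))

lemma idLE_of_isTors [IsNoetherianRing R] {a : Ideal R} {s : ℕ} (hM : IsTors a M)
    (h : ∀ (X : Type u) [AddCommGroup X] [Module R X], IsTors a X →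
      Subsingleton (EExt R X M (s + 1))) : IdLE R s M := by
  induction s generalizing M with
  | zero =>
    obtain ⟨E, _, _, f, hE, hT, hf⟩ := exists_torsion_injective_embedding hM
    exact idLE_zero_iff.2 (injective_of_ext_one (SES.mkQ f hf)
      (h _ (hT.of_surjective _ (Submodule.mkQ_surjective _))))
  | succ s ih =>
    obtain ⟨E, _, _, f, hE, hT, hf⟩ := exists_torsion_injective_embedding hM
    exact (idLE_succ_iff (SES.mkQ f hf)).2 (ih (hT.of_surjective _ (Submodule.mkQ_surjective _))
      fun X _ _ hX => cov_sub₃ (SES.mkQ f hf) (EExt_injective _ E s) (h X hX))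

lemma exact_factor_sup (I : Ideal R) (x : R) (φ : X →ₗ[R] R ⧸ I)
    (hφ : LinearMap.range φ = R ∙ (Submodule.Quotient.mk x : R ⧸ I)) :
    Function.Exact φ
      (Submodule.factor le_sup_left : (R ⧸ I) →ₗ[R] (R ⧸ (I ⊔ Ideal.span {x}))) := by
  rw [LinearMap.exact_iff, hφ]
  ext y
  obtain ⟨y, rfl⟩ := Submodule.Quotient.mk_surjective _ y
  rw [LinearMap.mem_ker, Submodule.mem_span_singleton]
  change Submodule.Quotient.mk y = 0 ↔ _
  rw [Submodule.Quotient.mk_eq_zero, Submodule.mem_sup]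
  constructor
  · rintro ⟨i, hi, z, hz, rfl⟩
    obtain ⟨r, rfl⟩ := Ideal.mem_span_singleton'.1 hz
    refine ⟨r, ?_⟩
    rw [← Submodule.Quotient.mk_smul, eq_comm, Submodule.Quotient.eq]
    simpa using hi
  · rintro ⟨r, hr⟩
    rw [← Submodule.Quotient.mk_smul, eq_comm, Submodule.Quotient.eq] at hr
    exact ⟨_, hr, r * x, Ideal.mem_span_singleton'.2 ⟨r, rfl⟩, by simp⟩

/-- `0 → R ⧸ (I : x) → R ⧸ I → R ⧸ (I + x) → 0`. -/
lemma exists_ses_colon (I : Ideal R) (x : R) : ∃ (J : Ideal R) (f : (R ⧸ J) →ₗ[R] (R ⧸ I))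
    (g : (R ⧸ I) →ₗ[R] (R ⧸ (I ⊔ Ideal.span {x}))), SES f g ∧ ∀ r, r ∈ J ↔ r * x ∈ I := by
  let φ : R →ₗ[R] R ⧸ I := LinearMap.toSpanSingleton R (R ⧸ I) (Submodule.Quotient.mk x)
  have hφ (r : R) : φ r = Submodule.Quotient.mk (r * x) := rfl
  refine ⟨LinearMap.ker φ, (LinearMap.ker φ).liftQ φ le_rfl, Submodule.factor le_sup_left,
    ⟨LinearMap.ker_eq_bot.1 (Submodule.ker_liftQ_eq_bot _ _ _ le_rfl), ?_,
      Submodule.factor_surjective _⟩, fun r => ?_⟩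
  · exact exact_factor_sup I x _ (by
      rw [Submodule.range_liftQ]; exact (LinearMap.span_singleton_eq_range R _ _).symm)
  · rw [LinearMap.mem_ker, hφ, Submodule.Quotient.mk_eq_zero]

lemma exists_ses_smul (I : Ideal R) (x : R) (hx : ∀ r, r * x ∈ I → r ∈ I) :
    ∃ g : (R ⧸ I) →ₗ[R] (R ⧸ (I ⊔ Ideal.span {x})),
      SES (x • (LinearMap.id : (R ⧸ I) →ₗ[R] (R ⧸ I))) g := by
  refine ⟨Submodule.factor le_sup_left, ?_, exact_factor_sup I x _ ?_,
    Submodule.factor_surjective _⟩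
  · rw [injective_iff_map_eq_zero]
    intro y hy
    obtain ⟨y, rfl⟩ := Submodule.Quotient.mk_surjective _ y
    rw [Submodule.Quotient.mk_eq_zero]
    apply hx
    rw [mul_comm]
    exact (Submodule.Quotient.mk_eq_zero _).1 hy
  · ext y
    rw [Submodule.mem_span_singleton]
    constructor
    · rintro ⟨y, rfl⟩
      obtain ⟨y, rfl⟩ := Submodule.Quotient.mk_surjective _ y
      refine ⟨y, ?_⟩
      change Submodule.Quotient.mk (y * x) = Submodule.Quotient.mk (x * y)
      rw [mul_comm]
    · rintro ⟨r, rfl⟩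
      refine ⟨Submodule.Quotient.mk r, ?_⟩
      change Submodule.Quotient.mk (x * r) = Submodule.Quotient.mk (r * x)
      rw [mul_comm]

/-- Noetherian induction reducing a statement about all ideals to primes. -/
lemma ideal_induction [IsNoetherianRing R] {P : Ideal R → Prop} (htop : P ⊤)
    (hses : ∀ (I J : Ideal R) (x : R) (f : (R ⧸ J) →ₗ[R] (R ⧸ I))
      (g : (R ⧸ I) →ₗ[R] (R ⧸ (I ⊔ Ideal.span {x}))), SES f g → I < J → x ∉ I → P J →
      P (I ⊔ Ideal.span {x}) → P I)
    (hprime : ∀ p : Ideal R, p.IsPrime → (∀ I, p < I → P I) → P p) (I : Ideal R) : P I := by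
  induction I using WellFoundedGT.induction with
  | ind I ih =>
    by_cases hI : I.IsPrime
    · exact hprime I hI ih
    rcases Ideal.not_isPrime_iff.1 hI with rfl | ⟨x, hx, y, hy, hxy⟩
    · exact htop
    obtain ⟨J, f, g, h, hJ⟩ := exists_ses_colon I x
    have hlt : I < J := lt_of_le_of_ne (fun r hr => (hJ r).2 (I.mul_mem_right _ hr)) (by
      rintro rfl
      exact hy ((hJ y).2 (by rwa [mul_comm])))
    exact hses I J x f g h hlt hx (ih J hlt) (ih _ (lt_of_le_of_ne le_sup_left (fun he => hx (by
      rw [he]; exact Ideal.mem_sup_right (Ideal.mem_span_singleton_self x)))))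

lemma subsingleton_of_smul_surjective [IsLocalRing R] [Module.Finite R M] {x : R}
    (hx : x ∈ IsLocalRing.maximalIdeal R) (h : ∀ m : M, ∃ m', x • m' = m) : Subsingleton M := by
  have : (⊤ : Submodule R M) = ⊥ := by
    refine Submodule.eq_bot_of_le_smul_of_le_jacobson_bot (IsLocalRing.maximalIdeal R) _
      Module.Finite.fg_top (fun m _ => ?_) (IsLocalRing.maximalIdeal_le_jacobson _)
    obtain ⟨m', rfl⟩ := h m
    exact Submodule.smul_mem_smul hx Submodule.mem_top
  exact (Submodule.subsingleton_iff R).1 (subsingleton_of_bot_eq_top this.symm)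

lemma idLE_of_residue [IsNoetherianRing R] [IsLocalRing R] [Module.Finite R M] {s : ℕ}
    (h : ∀ i, s < i → Subsingleton (EExt R (R ⧸ IsLocalRing.maximalIdeal R) M i)) :
    IdLE R s M := by
  suffices ∀ I : Ideal R, ∀ i, s < i → Subsingleton (EExt R (R ⧸ I) M i) from
    idLE_of_cyclic fun I => this I _ (Nat.lt_succ_self s)
  refine ideal_induction ?_ ?_ ?_
  · intro i _
    have : Subsingleton (R ⧸ (⊤ : Ideal R)) := Ideal.Quotient.subsingleton_iff.2 rfl
    exact EExt_sub_of_sub_left i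
  · intro I J x f g hs _ _ hJ hx i hi
    exact con_sub₂ hs (hJ i hi) (hx i hi)
  · intro p hp ih i hi
    by_cases hpm : p = IsLocalRing.maximalIdeal R
    · rw [hpm]; exact h i hi
    obtain ⟨x, hxm, hxp⟩ := SetLike.exists_of_lt
      (lt_of_le_of_ne (IsLocalRing.le_maximalIdeal hp.ne_top) hpm)
    obtain ⟨g, hs⟩ := exists_ses_smul p x fun r hr => (hp.mem_or_mem hr).resolve_right hxp
    have := ih (p ⊔ Ideal.span {x}) (lt_of_le_of_ne le_sup_left (fun he => hxp (by
      rw [he]; exact Ideal.mem_sup_right (Ideal.mem_span_singleton_self x)))) (i + 1) (by omega)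
    refine subsingleton_of_smul_surjective (R := R) hxm fun e => ?_
    obtain ⟨y, rfl⟩ := con_exact₁ hs i e (Subsingleton.elim _ _)
    exact ⟨y, (pre_lsmul x i y).symm⟩

end InjDim

section Vanishing

variable {R : Type u} [CommRing R] {a : Ideal R}
variable {M N X : Type u} [AddCommGroup M] [Module R M] [AddCommGroup N] [Module R N]
  [AddCommGroup X] [Module R X]

lemma subsingleton_of_isTors_of_injective (hM : IsTors a M) {x : R} (hx : x ∈ a)
    (h : ∀ m : M, x • m = 0 → m = 0) : Subsingleton M := by
  have hpow (t : ℕ) : ∀ m : M, x ^ t • m = 0 → m = 0 := by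
    induction t with
    | zero => simp
    | succ t ih => exact fun m hm => h m (ih _ (by rwa [smul_smul, ← pow_succ]))
  have (m : M) : m = 0 := by
    obtain ⟨t, ht⟩ := hM m
    exact hpow t m (ht _ (Ideal.pow_mem_pow hx t))
  exact ⟨fun x y => by rw [this x, this y]⟩

lemma ringKrullDim_quotient_anti {I J : Ideal R} (h : I ≤ J) :
    ringKrullDim (R ⧸ J) ≤ ringKrullDim (R ⧸ I) :=
  ringKrullDim_le_of_surjective (Ideal.Quotient.factor h) (Ideal.Quotient.factor_surjective h)

lemma ringKrullDim_quotient_sup_succ_le {p : Ideal R} (hp : p.IsPrime) {x : R} (hx : x ∉ p) :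
    ringKrullDim (R ⧸ (p ⊔ Ideal.span {x})) + 1 ≤ ringKrullDim (R ⧸ p) := by
  refine ringKrullDim_succ_le_of_surjective (Ideal.Quotient.factor le_sup_left)
    (Ideal.Quotient.factor_surjective le_sup_left) (r := Ideal.Quotient.mk p x) ?_ ?_
  · rw [mem_nonZeroDivisors_iff_ne_zero]
    exact fun h => hx (Ideal.Quotient.eq_zero_iff_mem.1 h)
  · rw [Ideal.Quotient.factor_mk, Ideal.Quotient.eq_zero_iff_mem]
    exact Ideal.mem_sup_right (Ideal.mem_span_singleton_self x)

lemma LCmap_lsmul' (i : ℕ) (x : R) (z : LC a i M) :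
    LCmap a i (x • (LinearMap.id : M →ₗ[R] M)) z = x • z := LCmap_lsmul x z

lemma isTors_quotient {I : Ideal R} (h : a ≤ I) : IsTors a (R ⧸ I) := fun y => by
  refine ⟨1, fun r hr => ?_⟩
  obtain ⟨y, rfl⟩ := Submodule.Quotient.mk_surjective _ y
  rw [← Submodule.Quotient.mk_smul, Submodule.Quotient.mk_eq_zero]
  exact I.mul_mem_right _ (h (by simpa using hr))

lemma ses_fin (M : Type u) [AddCommGroup M] [Module R M] (m : ℕ) :
    SES (LinearMap.single R (fun _ : Fin (m + 1) => M) 0) (LinearMap.funLeft R M Fin.succ) := by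
  refine ⟨fun x y h => by simpa using congrFun h 0, fun v => ⟨fun hv => ⟨v 0, ?_⟩, ?_⟩, fun v => ?_⟩
  · ext j
    refine Fin.cases (by simp) (fun j => ?_) j
    simpa using (congrFun hv j).symm
  · rintro ⟨w, rfl⟩
    ext j
    simp [LinearMap.funLeft_apply]
  · exact ⟨Fin.cons 0 v, by ext j; simp [LinearMap.funLeft_apply]⟩

lemma hom_sub_of_Gam (hX : IsTors a X) (hN : Gam a N = ⊥) : Subsingleton (X →ₗ[R] N) := by
  have (f : X →ₗ[R] N) : f = 0 := by
    ext x
    obtain ⟨t, ht⟩ := hX x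
    have : f x ∈ Gam a N := ⟨t, fun r hr => by rw [← map_smul, ht r hr, map_zero]⟩
    rwa [hN] at this
  exact ⟨fun f g => by rw [this f, this g]⟩

lemma LC_fin_sub {i : ℕ} (h : Subsingleton (LC a i M)) (m : ℕ) :
    Subsingleton (LC a i (Fin m → M)) := by
  induction m with
  | zero => exact LC_subsingleton_of_subsingleton a i
  | succ m ih => exact LC_sub₂ a (ses_fin M m) h ih

variable [IsNoetherianRing R]

lemma LC_quotient_sub (a : Ideal R) (I : Ideal R) :
    ∀ i : ℕ, ringKrullDim (R ⧸ I) < i → Subsingleton (LC a i (R ⧸ I)) := by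
  refine ideal_induction (P := fun I => ∀ i : ℕ, ringKrullDim (R ⧸ I) < i →
    Subsingleton (LC a i (R ⧸ I))) ?_ ?_ ?_ I
  · intro i _
    have : Subsingleton (R ⧸ (⊤ : Ideal R)) := Ideal.Quotient.subsingleton_iff.2 rfl
    exact LC_subsingleton_of_subsingleton a i
  · intro I J x f g hs hIJ _ hJ hx i hi
    exact LC_sub₂ a hs (hJ i ((ringKrullDim_quotient_anti hIJ.le).trans_lt hi))
      (hx i ((ringKrullDim_quotient_anti le_sup_left).trans_lt hi))
  · intro p hp ih i hi
    have hne : Nontrivial (R ⧸ p) := Ideal.Quotient.nontrivial_iff.2 hp.ne_top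
    have h0 : i ≠ 0 := by
      rintro rfl
      exact absurd hi (not_lt.2 (by exact_mod_cast ringKrullDim_nonneg_of_nontrivial))
    obtain ⟨j, rfl⟩ := Nat.exists_eq_add_one_of_ne_zero h0
    by_cases hap : a ≤ p
    · exact LC_sub_of_isTors j (isTors_quotient hap)
    obtain ⟨x, hxa, hxp⟩ := SetLike.not_le_iff_exists.1 hap
    obtain ⟨g, hs⟩ := exists_ses_smul p x fun r hr => (hp.mem_or_mem hr).resolve_right hxp
    have hlt : ringKrullDim (R ⧸ (p ⊔ Ideal.span {x})) < j := by
      have := (ringKrullDim_quotient_sup_succ_le hp hxp).trans_lt hi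
      push_cast at this
      exact lt_of_add_lt_add_right this
    have := ih (p ⊔ Ideal.span {x}) (lt_of_le_of_ne le_sup_left (fun he => hxp (by
      rw [he]; exact Ideal.mem_sup_right (Ideal.mem_span_singleton_self x)))) j hlt
    refine subsingleton_of_isTors_of_injective (isTors_LC (j + 1)) hxa fun z hz => ?_
    rw [← LCmap_lsmul' (j + 1)] at hz
    obtain ⟨y, rfl⟩ := (LC_exact₁ a j hs z).1 hz
    rw [Subsingleton.elim y 0, map_zero]

lemma LC_sub_of_annihilator (a : Ideal R) [Module.Finite R M] :
    ∀ i : ℕ, ringKrullDim (R ⧸ Module.annihilator R M) < i → Subsingleton (LC a i M) := by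
  refine IsNoetherianRing.induction_on_isQuotientEquivQuotientPrime R (M := M)
    (motive := fun M _ _ _ => ∀ i : ℕ, ringKrullDim (R ⧸ Module.annihilator R M) < i →
      Subsingleton (LC a i M)) inferInstance ?_ ?_ ?_
  · intro N _ _ _ _ i _
    exact LC_subsingleton_of_subsingleton a i
  · intro N _ _ _ p e i hi
    refine LC_congr_sub a e.symm (LC_quotient_sub a _ i ?_)
    rwa [e.annihilator_eq, Ideal.annihilator_quotient] at hi
  · intro N₁ _ _ _ N₂ _ _ _ N₃ _ _ _ f g hf hg hfg h1 h3 i hi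
    refine LC_sub₂ a ⟨hf, hfg, hg⟩ (h1 i ?_) (h3 i ?_)
    · exact (ringKrullDim_quotient_anti (f.annihilator_le_of_injective hf)).trans_lt hi
    · exact (ringKrullDim_quotient_anti (g.annihilator_le_of_surjective hg)).trans_lt hi

lemma LC_sub_of_killed {I : Ideal R} [Module.Finite R M] (hI : ∀ r ∈ I, ∀ m : M, r • m = 0)
    {i : ℕ} (hi : ringKrullDim (R ⧸ I) < i) : Subsingleton (LC a i M) :=
  LC_sub_of_annihilator a i ((ringKrullDim_quotient_anti
    (fun r hr => Module.mem_annihilator.2 (hI r hr))).trans_lt hi)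

lemma LC_sub_of_finite [Module.Finite R M] {i : ℕ} (hi : ringKrullDim R < i) :
    Subsingleton (LC a i M) :=
  LC_sub_of_annihilator a i ((ringKrullDim_le_of_surjective (Ideal.Quotient.mk _)
    Ideal.Quotient.mk_surjective).trans_lt hi)

lemma LC_sub_of_ring {n : ℕ} {d : ℕ} (hd : ringKrullDim R ≤ d)
    (h : ∀ i, n < i → Subsingleton (LC a i R)) [Module.Finite R M] {i : ℕ} (hi : n < i) :
    Subsingleton (LC a i M) := by
  suffices ∀ (k : ℕ) (M : Type u) [AddCommGroup M] [Module R M] [Module.Finite R M] (i : ℕ),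
      n < i → d < i + k → Subsingleton (LC a i M) from this (d + 1) M i hi (by omega)
  intro k
  induction k with
  | zero =>
    intro M _ _ _ i _ hi
    exact LC_sub_of_finite (hd.trans_lt (by exact_mod_cast hi))
  | succ k ih =>
    intro M _ _ _ i hi hk
    obtain ⟨m, g, hg⟩ := Module.Finite.exists_fin' R M
    exact LC_sub₃ a (SES.ker g hg) (LC_fin_sub (h i hi) m) (ih _ (i + 1) (by omega) (by omega))

lemma ext_sub_of_LC_sub (hX : IsTors a X) (i : ℕ) :
    ∀ (N : Type u) [AddCommGroup N] [Module R N], (∀ j, Subsingleton (LC a j N)) →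
      Subsingleton (EExt R X N i) := by
  induction i with
  | zero =>
    intro N _ _ h
    exact EExt_zero_sub.2 (hom_sub_of_Gam hX ((LC_zero_sub a).1 (h 0)))
  | succ i ih =>
    intro N _ _ h
    obtain ⟨E, _, _, f, hE, hT, hf⟩ := exists_torsionfree_injective_embedding
      ((LC_zero_sub a).1 (h 0))
    have hE' : ∀ j, Subsingleton (LC a j E)
      | 0 => (LC_zero_sub a).2 hT
      | j + 1 => LC_injective a E j
    exact cov_sub₁ (SES.mkQ f hf) (ih _ fun j => LC_sub₃ a (SES.mkQ f hf) (hE' j) (h (j + 1)))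
      (EExt_injective X E i)

lemma ext_sub_iff_LC (hX : IsTors a X) (n : ℕ) :
    ∀ (M : Type u) [AddCommGroup M] [Module R M], (∀ j, j ≠ n → Subsingleton (LC a j M)) →
      ∀ i, Subsingleton (EExt R X M (i + n)) ↔ Subsingleton (EExt R X (LC a n M) i) := by
  induction n with
  | zero =>
    intro M _ _ h i
    have hQ : ∀ j, Subsingleton (LC a j (M ⧸ Gam a M))
      | 0 => (LC_zero_sub a).2 (Gam_quotient M)
      | j + 1 => (LCmodGam a M j).toEquiv.subsingleton_congr.1 (h (j + 1) (by omega))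
    have hQ' := fun j => ext_sub_of_LC_sub hX j _ hQ
    rw [(EExtCongrRight X (LC0 a M) i).toEquiv.subsingleton_congr, add_zero]
    refine ⟨fun hM => ?_, fun hG => cov_sub₂ (SES.submodule (Gam a M)) hG (hQ' i)⟩
    cases i with
    | zero =>
      rw [EExt_zero_sub] at hM ⊢
      refine ⟨fun f g => ?_⟩
      have := Subsingleton.elim ((Gam a M).subtype ∘ₗ f) ((Gam a M).subtype ∘ₗ g)
      ext x
      exact LinearMap.congr_fun this x
    | succ i => exact cov_sub₁ (SES.submodule (Gam a M)) (hQ' i) hM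
  | succ n ih =>
    intro M _ _ h i
    obtain ⟨E, _, _, f, hE, hT, hf⟩ := exists_torsionfree_injective_embedding
      ((LC_zero_sub a).1 (h 0 (by omega)))
    have hs := SES.mkQ f hf
    have hE' : ∀ j, Subsingleton (LC a j E)
      | 0 => (LC_zero_sub a).2 hT
      | j + 1 => LC_injective a E j
    have hE'' := ext_sub_of_LC_sub hX (i + n) E hE'
    rw [← (EExtCongrRight X (LCδEquiv a hs (hE' n) (hE' (n + 1))) i).toEquiv.subsingleton_congr,
      ← ih _ (fun j hj => LC_sub₃ a hs (hE' j) (h (j + 1) (by omega))) i]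
    exact ⟨fun hM => cov_sub₃ hs hE'' hM, fun hD => cov_sub₁ hs hD (EExt_injective X E (i + n))⟩

lemma idLE_LC {n s : ℕ} (h : ∀ j, j ≠ n → Subsingleton (LC a j M)) (hM : IdLE R (n + s) M) :
    IdLE R s (LC a n M) :=
  idLE_of_isTors (isTors_LC n) fun X _ _ hX =>
    (ext_sub_iff_LC hX n M h (s + 1)).1 (hM X _ (by omega))

lemma le_of_idLE {n s : ℕ} (h : ∀ j, j ≠ n → Subsingleton (LC a j M)) (hM : IdLE R s M)
    (hne : Nontrivial (LC a n M)) : n ≤ s := by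
  by_contra hlt
  have := (ext_sub_iff_LC (isTors_LC n) n M h 0).1 (hM (LC a n M) _ (by omega))
  rw [EExt_zero_sub] at this
  obtain ⟨x, y, hxy⟩ := hne
  have := Subsingleton.elim (LinearMap.id : LC a n M →ₗ[R] LC a n M) 0
  exact hxy (by rw [← LinearMap.id_apply (R := R) x, ← LinearMap.id_apply (R := R) y, this]; rfl)

lemma idLE_of_LC [IsLocalRing R] [Module.Finite R M] {n s : ℕ}
    (ha : a ≤ IsLocalRing.maximalIdeal R)
    (h : ∀ j, j ≠ n → Subsingleton (LC a j M)) (hK : IdLE R s (LC a n M)) :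
    IdLE R (n + s) M := by
  refine idLE_of_residue fun i hi => ?_
  obtain ⟨j, rfl⟩ := Nat.exists_eq_add_of_le' (show n ≤ i by omega)
  exact (ext_sub_iff_LC (isTors_quotient ha) n M h j).2 (hK _ j (by omega))

end Vanishing

section HomSES

variable {R : Type u} [CommRing R] {a : Ideal R}
variable {A B D X E : Type u} [AddCommGroup A] [Module R A] [AddCommGroup B] [Module R B]
  [AddCommGroup D] [Module R D] [AddCommGroup X] [Module R X] [AddCommGroup E] [Module R E]
  {f : A →ₗ[R] B} {g : B →ₗ[R] D}

lemma ses_hom_con (h : SES f g) (E : Type u) [AddCommGroup E] [Module R E]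
    [Module.Injective R E] : SES (LinearMap.lcomp R E g) (LinearMap.lcomp R E f) := by
  refine ⟨fun k l hkl => ?_, fun k => ⟨fun hk => ?_, ?_⟩, fun k => ?_⟩
  · ext d
    obtain ⟨b, rfl⟩ := h.surj d
    exact LinearMap.congr_fun hkl b
  · have hle : LinearMap.ker g ≤ LinearMap.ker k := by
      intro b hb
      obtain ⟨x, rfl⟩ := (h.exact b).1 hb
      exact LinearMap.congr_fun hk x
    let e := g.quotKerEquivOfSurjective h.surj
    refine ⟨(LinearMap.ker g).liftQ k hle ∘ₗ e.symm.toLinearMap, ?_⟩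
    ext b
    have : e.symm (g b) = Submodule.Quotient.mk b := by
      rw [LinearEquiv.symm_apply_eq]; rfl
    change (LinearMap.ker g).liftQ k hle (e.symm (g b)) = k b
    rw [this]; rfl
  · rintro ⟨l, rfl⟩
    ext x
    change l (g (f x)) = 0
    rw [h.exact.apply_apply_eq_zero, map_zero]
  · obtain ⟨l, hl⟩ := Module.Injective.out f h.inj k
    exact ⟨l, LinearMap.ext hl⟩

lemma ses_hom_cov (h : SES f g) (X : Type u) [AddCommGroup X] [Module R X]
    (hX : Subsingleton (EExt R X A 1)) :
    SES (LinearMap.compRight R f : (X →ₗ[R] A) →ₗ[R] (X →ₗ[R] B)) (LinearMap.compRight R g) := by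
  refine ⟨fun k l hkl => ?_, fun k => ⟨fun hk => ?_, ?_⟩, covδ_hom_surj h hX⟩
  · ext x
    exact h.inj (LinearMap.congr_fun hkl x)
  · choose l hl using fun x => (h.exact (k x)).1 (LinearMap.congr_fun hk x)
    refine ⟨⟨⟨l, fun x y => h.inj (by simp [hl])⟩, fun r x => h.inj (by simp [hl])⟩, ?_⟩
    ext x
    exact hl x
  · rintro ⟨l, rfl⟩
    ext x
    exact h.exact.apply_apply_eq_zero _

lemma Gam_map_surjective (h : SES f g) (hA : Subsingleton (LC a 1 A)) :
    Function.Surjective (Gam.map a g) := by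
  intro d
  obtain ⟨z, rfl⟩ := (LC0 a D).surjective d
  obtain ⟨y, rfl⟩ := (LC_exact₃ a 0 h z).1 (Subsingleton.elim _ _)
  exact ⟨LC0 a B y, (LC0_map g y).symm⟩

lemma LC_one_sub (h : SES f g) (hB : Subsingleton (LC a 1 B))
    (hs : Function.Surjective (Gam.map a g)) : Subsingleton (LC a 1 A) := by
  have (z : LC a 1 A) : z = 0 := by
    obtain ⟨d, rfl⟩ := (LC_exact₁ a 0 h z).1 (Subsingleton.elim _ _)
    obtain ⟨b, hb⟩ := hs (LC0 a D d)
    obtain ⟨b, rfl⟩ := (LC0 a B).surjective b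
    rw [← LC0_map] at hb
    exact (LC_exact₃ a 0 h d).2 ⟨b, (LC0 a D).injective hb⟩
  exact ⟨fun x y => by rw [this x, this y]⟩

lemma ses_Gam (h : SES f g) (hA : Subsingleton (LC a 1 A)) :
    SES (Gam.map a f) (Gam.map a g) := by
  refine ⟨fun x y hxy => Subtype.ext (h.inj (congrArg Subtype.val hxy)),
    fun b => ⟨fun hb => ?_, ?_⟩, Gam_map_surjective h hA⟩
  · obtain ⟨x, hx⟩ := (h.exact (b : B)).1 (congrArg Subtype.val hb)
    obtain ⟨t, ht⟩ := b.2
    exact ⟨⟨x, t, fun r hr => h.inj (by rw [map_smul, hx, ht r hr, map_zero])⟩, Subtype.ext hx⟩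
  · rintro ⟨x, rfl⟩
    exact Subtype.ext (h.exact.apply_apply_eq_zero _)

/-- `Γ_a(Hom(X, E)) = Hom(X, Γ_a(E))` for finitely generated `X`. -/
def GamHom (a : Ideal R) (X E : Type u) [AddCommGroup X] [Module R X] [AddCommGroup E] [Module R E]
    [Module.Finite R X] : Gam a (X →ₗ[R] E) ≃ₗ[R] (X →ₗ[R] Gam a E) :=
  LinearEquiv.symm <| LinearEquiv.ofBijective
    ((LinearMap.compRight R (Gam a E).subtype).codRestrict (Gam a (X →ₗ[R] E)) (fun φ => by
      obtain ⟨t, ht⟩ := (isTors_Gam.of_injective (LinearMap.range φ).subtype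
        (Submodule.injective_subtype _)).exists_of_fg
      refine ⟨t, fun r hr => LinearMap.ext fun x => ?_⟩
      exact congrArg (fun z => (z.1 : E)) (ht r hr ⟨φ x, x, rfl⟩))) <| by
    constructor
    · intro k l hkl
      ext x
      exact LinearMap.congr_fun (congrArg Subtype.val hkl) x
    · rintro ⟨φ, t, ht⟩
      exact ⟨φ.codRestrict _ (fun x => ⟨t, fun r hr => LinearMap.congr_fun (ht r hr) x⟩), rfl⟩

end HomSES

section Acyclic

variable {R : Type u} [CommRing R] [IsNoetherianRing R] {a : Ideal R}

lemma LC_hom_injective (E : Type u) [AddCommGroup E] [Module R E] [Module.Injective R E] (i : ℕ) :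
    ∀ (X : Type u) [AddCommGroup X] [Module R X] [Module.Finite R X],
      Subsingleton (LC a (i + 1) (X →ₗ[R] E)) := by
  have hfree (m j : ℕ) : Subsingleton (LC a (j + 1) ((Fin m → R) →ₗ[R] E)) :=
    LC_congr_sub a (LinearEquiv.piRing R E (Fin m) R).symm (LC_fin_sub (LC_injective a E j) m)
  induction i with
  | zero =>
    intro X _ _ _
    obtain ⟨m, g, hg⟩ := Module.Finite.exists_fin' R X
    refine LC_one_sub (ses_hom_con (SES.ker g hg) E) (hfree m 0) fun φ => ?_
    obtain ⟨k, hk⟩ := Module.Injective.out (LinearMap.ker g).subtype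
      (Submodule.injective_subtype _) (GamHom a _ E φ)
    refine ⟨(GamHom a _ E).symm k, ?_⟩
    obtain ⟨ψ, rfl⟩ := (GamHom a _ E).symm.surjective φ
    rw [LinearEquiv.apply_symm_apply] at hk
    refine Subtype.ext (LinearMap.ext fun x => ?_)
    exact congrArg Subtype.val (hk x)
  | succ i ih =>
    intro X _ _ _
    obtain ⟨m, g, hg⟩ := Module.Finite.exists_fin' R X
    exact LC_sub₁ a (ses_hom_con (SES.ker g hg) E) (ih _) (hfree m (i + 1))

variable {C N : Type u} [AddCommGroup C] [Module R C] [AddCommGroup N] [Module R N]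

lemma subsingleton_of_hom_subsingleton [Module.Finite R C] (hC : Module.annihilator R C = ⊥)
    (h : Subsingleton (C →ₗ[R] N)) : Subsingleton N := by
  have (x : N) : x = 0 := by
    have : Subsingleton (C →ₗ[R] (R ∙ x)) := by
      refine ⟨fun k l => ?_⟩
      have := Subsingleton.elim ((R ∙ x).subtype ∘ₗ k) ((R ∙ x).subtype ∘ₗ l)
      ext c
      exact LinearMap.congr_fun this c
    obtain ⟨r, hr, hreg⟩ := IsSMulRegular.subsingleton_linearMap_iff.1 this
    rw [hC, Submodule.mem_bot] at hr
    subst hr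
    have : (⟨x, Submodule.mem_span_singleton_self x⟩ : (R ∙ x)) = 0 := hreg (by simp)
    exact congrArg Subtype.val this
  exact ⟨fun x y => by rw [this x, this y]⟩

/-- `N` is `Hom(C, -)`-acyclic and the local cohomology of `Hom(C, N)` is concentrated in
degree `n`, while that of `N` vanishes above degree `n`. -/
structure Concentrated (a : Ideal R) (C : Type u) [AddCommGroup C] [Module R C] (n : ℕ)
    (N : Type u) [AddCommGroup N] [Module R N] : Prop where
  ext : ∀ i, Subsingleton (EExt R C N (i + 1))
  hom : ∀ i, i ≠ n → Subsingleton (LC a i (C →ₗ[R] N))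
  up : ∀ i, n < i → Subsingleton (LC a i N)

lemma Concentrated.ext_Gam [Module.Finite R C] (i : ℕ) :
    ∀ (N : Type u) [AddCommGroup N] [Module R N], Concentrated a C 0 N →
      Subsingleton (EExt R C (Gam a N) (i + 1)) := by
  induction i with
  | zero =>
    intro N _ _ h
    obtain ⟨E, _, _, f, hE, hf⟩ := exists_injective_embedding R N
    have hs := SES.mkQ f hf
    refine EExt_one_sub (ses_Gam hs (h.up 1 one_pos)) (EExt_injective C _ 0) fun k => ?_
    obtain ⟨φ, hφ⟩ := Gam_map_surjective (ses_hom_cov hs C (h.ext 0)) (h.hom 1 one_ne_zero)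
      ((GamHom a C _).symm k)
    refine ⟨GamHom a C E φ, ?_⟩
    obtain ⟨ψ, rfl⟩ := (GamHom a C E).symm.surjective φ
    rw [LinearEquiv.apply_symm_apply]
    refine LinearMap.ext fun c => Subtype.ext ?_
    exact LinearMap.congr_fun (congrArg Subtype.val hφ) c
  | succ i ih =>
    intro N _ _ h
    obtain ⟨E, _, _, f, hE, hf⟩ := exists_injective_embedding R N
    have hs := SES.mkQ f hf
    refine cov_sub₁ (ses_Gam hs (h.up 1 one_pos))
      (ih _ ⟨fun j => ?_, fun j hj => ?_, fun j hj => ?_⟩)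
      (EExt_injective C _ _)
    · exact cov_sub₃ hs (EExt_injective C E j) (h.ext (j + 1))
    · obtain ⟨j, rfl⟩ := Nat.exists_eq_add_one_of_ne_zero hj
      exact LC_sub₃ a (ses_hom_cov hs C (h.ext 0)) (LC_hom_injective E j C)
        (h.hom _ (by omega))
    · obtain ⟨j, rfl⟩ := Nat.exists_eq_add_one_of_ne_zero hj.ne'
      exact LC_sub₃ a hs (LC_injective a E j) (h.up _ (by omega))

lemma Concentrated.main [Module.Finite R C] (hC : Module.annihilator R C = ⊥) (n : ℕ) :
    ∀ (N : Type u) [AddCommGroup N] [Module R N], Concentrated a C n N →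
      (∀ i, i ≠ n → Subsingleton (LC a i N)) ∧
      Nonempty (LC a n (C →ₗ[R] N) ≃ₗ[R] (C →ₗ[R] LC a n N)) ∧
      ∀ i, Subsingleton (EExt R C (LC a n N) (i + 1)) := by
  induction n with
  | zero =>
    intro N _ _ h
    refine ⟨fun i hi => h.up i (Nat.pos_of_ne_zero hi),
      ⟨(LC0 a _).trans ((GamHom a C N).trans (LinearEquiv.congrRight (LC0 a N).symm))⟩,
      fun i => EExt_sub_right (LC0 a N).symm (Concentrated.ext_Gam i N h)⟩
  | succ n ih =>
    intro N _ _ h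
    have hΓ : Gam a N = ⊥ := by
      rw [← Submodule.subsingleton_iff_eq_bot]
      refine subsingleton_of_hom_subsingleton hC ?_
      refine (GamHom a C N).toEquiv.subsingleton_congr.1 ?_
      exact (LC0 a _).toEquiv.subsingleton_congr.1 (h.hom 0 (by omega))
    obtain ⟨E, _, _, f, hE, hT, hf⟩ := exists_torsionfree_injective_embedding hΓ
    have hs := SES.mkQ f hf
    have hs' := ses_hom_cov hs C (h.ext 0)
    have hE' : ∀ j, Subsingleton (LC a j E)
      | 0 => (LC_zero_sub a).2 hT
      | j + 1 => LC_injective a E j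
    have hE'' : ∀ j, Subsingleton (LC a j (C →ₗ[R] E))
      | 0 => by
        rw [(LC0 a _).toEquiv.subsingleton_congr, (GamHom a C E).toEquiv.subsingleton_congr]
        have := (Submodule.subsingleton_iff_eq_bot).2 hT
        infer_instance
      | j + 1 => LC_hom_injective E j C
    obtain ⟨h1, ⟨e⟩, h3⟩ := ih _ ⟨fun j => cov_sub₃ hs (EExt_injective C E j) (h.ext (j + 1)),
      fun j hj => LC_sub₃ a hs' (hE'' j) (h.hom (j + 1) (by omega)),
      fun j hj => LC_sub₃ a hs (hE' j) (h.up (j + 1) (by omega))⟩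
    let δ := LCδEquiv a hs (hE' n) (hE' (n + 1))
    refine ⟨fun i hi => ?_, ⟨(LCδEquiv a hs' (hE'' n) (hE'' (n + 1))).symm.trans
      (e.trans (LinearEquiv.congrRight δ))⟩, fun i => EExt_sub_right δ (h3 i)⟩
    cases i with
    | zero => exact (LC_zero_sub a).2 hΓ
    | succ i => exact LC_sub₁ a hs (h1 i (by omega)) (hE' (i + 1))

end Acyclic

section EilenbergWatts
open TensorProduct

variable {R : Type u} [CommRing R]
variable {A B D : Type u} [AddCommGroup A] [Module R A] [AddCommGroup B] [Module R B]
  [AddCommGroup D] [Module R D]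

variable (G : ModuleCat.{u} R ⥤ ModuleCat.{u} R)

/-- The value of a functor on an unbundled linear map. -/
abbrev fmap (f : A →ₗ[R] B) : G.obj (.of R A) →ₗ[R] G.obj (.of R B) :=
  (G.map (ModuleCat.ofHom f)).hom

lemma fmap_id (z : G.obj (.of R A)) : fmap G (LinearMap.id : A →ₗ[R] A) z = z := by
  simp [fmap]

lemma fmap_comp (f : A →ₗ[R] B) (g : B →ₗ[R] D) (z : G.obj (.of R A)) :
    fmap G (g ∘ₗ f) z = fmap G g (fmap G f z) := by
  simp [fmap, ModuleCat.ofHom_comp]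

lemma fmap_add [G.Additive] (f g : A →ₗ[R] B) : fmap G (f + g) = fmap G f + fmap G g := by
  simp only [fmap, ModuleCat.ofHom_add, G.map_add, ModuleCat.hom_add]

lemma fmap_smul [G.Additive] [Functor.Linear R G] (r : R) (f : A →ₗ[R] B) :
    fmap G (r • f) = r • fmap G f := by
  simp only [fmap]
  rw [show ModuleCat.ofHom (r • f) = r • ModuleCat.ofHom f from rfl, Functor.map_smul]
  rfl

/-- Right exactness on short exact sequences of finite modules. -/
structure RightExactFG : Prop where
  surj : ∀ {A B D : Type u} [AddCommGroup A] [Module R A] [AddCommGroup B] [Module R B]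
    [AddCommGroup D] [Module R D] [Module.Finite R A] [Module.Finite R B] [Module.Finite R D]
    {f : A →ₗ[R] B} {g : B →ₗ[R] D}, SES f g → Function.Surjective (fmap G g)
  exact : ∀ {A B D : Type u} [AddCommGroup A] [Module R A] [AddCommGroup B] [Module R B]
    [AddCommGroup D] [Module R D] [Module.Finite R A] [Module.Finite R B] [Module.Finite R D]
    {f : A →ₗ[R] B} {g : B →ₗ[R] D}, SES f g → Function.Exact (fmap G f) (fmap G g)

variable [G.Additive] [Functor.Linear R G]

/-- The canonical map `Z ⊗ G(R) → G(Z)`. -/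
def ewMap (Z : Type u) [AddCommGroup Z] [Module R Z] :
    Z ⊗[R] G.obj (.of R R) →ₗ[R] G.obj (.of R Z) :=
  TensorProduct.lift
    { toFun := fun z => fmap G (LinearMap.toSpanSingleton R Z z)
      map_add' := fun x y => by rw [← fmap_add, LinearMap.toSpanSingleton_add]
      map_smul' := fun r x => by
        rw [RingHom.id_apply, ← fmap_smul, LinearMap.toSpanSingleton_smul] }

lemma ewMap_tmul (z : A) (h : G.obj (.of R R)) :
    ewMap G A (z ⊗ₜ h) = fmap G (LinearMap.toSpanSingleton R A z) h := rfl

lemma ewMap_natural (f : A →ₗ[R] B) (t : A ⊗[R] G.obj (.of R R)) :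
    ewMap G B (f.rTensor _ t) = fmap G f (ewMap G A t) := by
  induction t with
  | zero => simp
  | add x y hx hy => rw [map_add, map_add, hx, hy, map_add, map_add]
  | tmul z h =>
    rw [LinearMap.rTensor_tmul, ewMap_tmul, ewMap_tmul, ← fmap_comp,
      LinearMap.comp_toSpanSingleton]

lemma ewMap_free (m : ℕ) : Function.Bijective (ewMap G (Fin m → R)) := by
  have hid : (LinearMap.id : (Fin m → R) →ₗ[R] (Fin m → R)) =
      ∑ j, LinearMap.toSpanSingleton R _ (Pi.single j 1) ∘ₗ LinearMap.proj j := by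
    refine LinearMap.ext fun v => ?_
    rw [LinearMap.sum_apply]
    ext k
    simp [Pi.single_apply]
  have hsum (s : Finset (Fin m)) (F : Fin m → ((Fin m → R) →ₗ[R] (Fin m → R))) :
      fmap G (∑ j ∈ s, F j) = ∑ j ∈ s, fmap G (F j) := by
    induction s using Finset.cons_induction with
    | empty =>
      rw [Finset.sum_empty, Finset.sum_empty,
        show (0 : (Fin m → R) →ₗ[R] (Fin m → R)) = (0 : R) • 0 by simp, fmap_smul, zero_smul]
    | cons j s hj ih => rw [Finset.sum_cons, Finset.sum_cons, fmap_add, ih]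
  constructor
  · rw [injective_iff_map_eq_zero]
    intro t ht
    have h1 (j : Fin m) :
        (LinearMap.proj j : (Fin m → R) →ₗ[R] R).rTensor (G.obj (.of R R)) t = 0 := by
      have h2 : ewMap G R ((LinearMap.proj j : (Fin m → R) →ₗ[R] R).rTensor _ t) = 0 := by
        rw [ewMap_natural, ht, map_zero]
      have h3 (s : R ⊗[R] G.obj (.of R R)) : ewMap G R s = TensorProduct.lid R _ s := by
        induction s with
        | zero => simp
        | add x y hx hy => rw [map_add, map_add, hx, hy]
        | tmul r h =>
          rw [ewMap_tmul, TensorProduct.lid_tmul,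
            show LinearMap.toSpanSingleton R R r = r • LinearMap.id by ext; simp, fmap_smul,
            LinearMap.smul_apply, fmap_id]
      rw [h3] at h2
      exact (TensorProduct.lid R _).injective (h2.trans (map_zero _).symm)
    rw [← LinearMap.id_apply (R := R) t, ← LinearMap.rTensor_id, hid,
      ← LinearMap.coe_rTensorHom, map_sum, LinearMap.sum_apply]
    refine Finset.sum_eq_zero fun j _ => ?_
    rw [LinearMap.coe_rTensorHom, LinearMap.rTensor_comp, LinearMap.comp_apply, h1, map_zero]
  · intro g
    refine ⟨∑ j, Pi.single j 1 ⊗ₜ fmap G (LinearMap.proj j) g, ?_⟩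
    rw [map_sum]
    conv_rhs => rw [← fmap_id G g, hid, hsum, LinearMap.sum_apply]
    refine Finset.sum_congr rfl fun j _ => ?_
    rw [ewMap_tmul, fmap_comp]

variable {G} [IsNoetherianRing R]

lemma ewMap_surjective (hG : RightExactFG G) [Module.Finite R A] :
    Function.Surjective (ewMap G A) := by
  obtain ⟨m, g, hg⟩ := Module.Finite.exists_fin' R A
  intro y
  obtain ⟨z, rfl⟩ := hG.surj (SES.ker g hg) y
  obtain ⟨t, rfl⟩ := (ewMap_free G m).2 z
  exact ⟨_, ewMap_natural G g t⟩

lemma ewMap_bijective (hG : RightExactFG G) (A : Type u) [AddCommGroup A] [Module R A]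
    [Module.Finite R A] : Function.Bijective (ewMap G A) := by
  refine ⟨?_, ewMap_surjective hG⟩
  obtain ⟨m, g, hg⟩ := Module.Finite.exists_fin' R A
  rw [injective_iff_map_eq_zero]
  intro t ht
  obtain ⟨s, rfl⟩ := LinearMap.rTensor_surjective _ hg t
  rw [ewMap_natural] at ht
  obtain ⟨w, hw⟩ := (hG.exact (SES.ker g hg) _).1 ht
  obtain ⟨v, rfl⟩ := ewMap_surjective hG w
  rw [← ewMap_natural] at hw
  rw [← (ewMap_free G m).1 hw]
  exact ((rTensor_exact _ (SES.ker g hg).exact hg) _).2 ⟨v, rfl⟩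

/-- Eilenberg–Watts for finite modules. -/
def ewEquiv (hG : RightExactFG G) (A : Type u) [AddCommGroup A] [Module R A]
    [Module.Finite R A] : A ⊗[R] G.obj (.of R R) ≃ₗ[R] G.obj (.of R A) :=
  LinearEquiv.ofBijective _ (ewMap_bijective hG A)

end EilenbergWatts

section Functors

variable {R : Type u} [CommRing R]

variable (R) in
/-- Local cohomology as a functor. -/
def LCfunctor (a : Ideal R) (n : ℕ) : ModuleCat.{u} R ⥤ ModuleCat.{u} R where
  obj M := .of R (LC a n M)
  map f := ModuleCat.ofHom (LCmap a n f.hom)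
  map_id M := by ext z; exact LCmap_id z
  map_comp f g := by ext z; exact LCmap_comp _ _ z

instance (a : Ideal R) (n : ℕ) : (LCfunctor R a n).Additive where
  map_add {M N f g} := by
    ext z; exact LinearMap.congr_fun (LCmap_add f.hom g.hom) z

instance (a : Ideal R) (n : ℕ) : (LCfunctor R a n).Linear R where
  map_smul {M N} f r := by
    ext z; exact LinearMap.congr_fun (LCmap_smul r f.hom) z

/-- `Z ↦ Hom(Hom(Z, C), I)`. -/
def HHfunctor (C I : Type u) [AddCommGroup C] [Module R C] [AddCommGroup I] [Module R I] :
    ModuleCat.{u} R ⥤ ModuleCat.{u} R where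
  obj M := .of R ((M →ₗ[R] C) →ₗ[R] I)
  map f := ModuleCat.ofHom (LinearMap.lcomp R I (LinearMap.lcomp R C f.hom))
  map_id M := by ext; rfl
  map_comp f g := by ext; rfl

variable (C I : Type u) [AddCommGroup C] [Module R C] [AddCommGroup I] [Module R I]

instance : (HHfunctor (R := R) C I).Additive where
  map_add {M N f g} := by
    refine ModuleCat.hom_ext (LinearMap.ext fun (φ : (M →ₗ[R] C) →ₗ[R] I) =>
      LinearMap.ext fun (ψ : N →ₗ[R] C) => ?_)
    change φ (ψ ∘ₗ (f.hom + g.hom)) = φ (ψ ∘ₗ f.hom) + φ (ψ ∘ₗ g.hom)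
    rw [LinearMap.comp_add, map_add]

instance : (HHfunctor (R := R) C I).Linear R where
  map_smul {M N} f r := by
    refine ModuleCat.hom_ext (LinearMap.ext fun (φ : (M →ₗ[R] C) →ₗ[R] I) =>
      LinearMap.ext fun (ψ : N →ₗ[R] C) => ?_)
    change φ (ψ ∘ₗ (r • f.hom)) = r • φ (ψ ∘ₗ f.hom)
    rw [LinearMap.comp_smul, map_smul]

lemma LCfunctor_rightExact {a : Ideal R} {n : ℕ} (h : ∀ (M : Type u) [AddCommGroup M] [Module R M]
    [Module.Finite R M], Subsingleton (LC a (n + 1) M)) : RightExactFG (LCfunctor R a n) where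
  surj {A B D} _ _ _ _ _ _ _ _ _ f g hs := fun d => by
    have := h A
    exact (LC_exact₃ a n hs d).1 (Subsingleton.elim _ _)
  exact hs := LC_exact₂ a n hs

lemma HHfunctor_rightExact [Module.Injective R I] : RightExactFG (HHfunctor (R := R) C I) where
  surj {A B D} _ _ _ _ _ _ _ _ _ f g hs := fun φ => by
    obtain ⟨k, hk⟩ := Module.Injective.out (LinearMap.lcomp R C g)
      (fun x y hxy => by
        ext d; obtain ⟨b, rfl⟩ := hs.surj d; exact LinearMap.congr_fun hxy b) φ
    exact ⟨k, LinearMap.ext hk⟩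
  exact {A B D} _ _ _ _ _ _ _ _ _ f g hs := fun (φ : (B →ₗ[R] C) →ₗ[R] I) => by
    constructor
    · intro hφ
      let ρ := LinearMap.lcomp R C f
      have hle : LinearMap.ker ρ ≤ LinearMap.ker φ := by
        intro ψ hψ
        have hker : LinearMap.ker g ≤ LinearMap.ker ψ := by
          intro b hb
          obtain ⟨x, rfl⟩ := (hs.exact b).1 hb
          exact LinearMap.congr_fun hψ x
        let e := g.quotKerEquivOfSurjective hs.surj
        have h2 :
            LinearMap.lcomp R C g ((LinearMap.ker g).liftQ ψ hker ∘ₗ e.symm.toLinearMap) = ψ := by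
          ext b
          have : e.symm (g b) = Submodule.Quotient.mk b := by
            rw [LinearEquiv.symm_apply_eq]; rfl
          change (LinearMap.ker g).liftQ ψ hker (e.symm (g b)) = ψ b
          rw [this]; rfl
        have h3 := LinearMap.congr_fun hφ
          ((LinearMap.ker g).liftQ ψ hker ∘ₗ e.symm.toLinearMap)
        rw [LinearMap.mem_ker, ← h2]
        exact h3
      obtain ⟨k, hk⟩ := Module.Injective.out ((LinearMap.ker ρ).liftQ ρ le_rfl)
        (LinearMap.ker_eq_bot.1 (Submodule.ker_liftQ_eq_bot _ _ _ le_rfl))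
        ((LinearMap.ker ρ).liftQ φ hle)
      exact ⟨k, LinearMap.ext fun ψ => hk (Submodule.Quotient.mk ψ)⟩
    · rintro ⟨(k : (A →ₗ[R] C) →ₗ[R] I), rfl⟩
      refine LinearMap.ext fun ψ => ?_
      change k ((ψ ∘ₗ g) ∘ₗ f) = 0
      rw [LinearMap.comp_assoc, hs.exact.linearMap_comp_eq_zero, LinearMap.comp_zero, map_zero]

end Functors

section Acyclic
open TensorProduct

variable {R : Type u} [CommRing R]
variable {A B D M : Type u} [AddCommGroup A] [Module R A] [AddCommGroup B] [Module R B]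
  [AddCommGroup D] [Module R D] [AddCommGroup M] [Module R M] {f : A →ₗ[R] B} {g : B →ₗ[R] D}

lemma conδ_pre (h : SES f g) (i : ℕ) (y : EExt R B M i) : conδ h M i (pre f M i y) = 0 := by
  change Abelian.Ext.comp _ ((Abelian.Ext.mk₀ _).comp y (zero_add _)) (add_comm 1 i) = 0
  have := h.shortExact.extClass_comp
  change h.shortExact.extClass.comp (Abelian.Ext.mk₀ (ModuleCat.ofHom f)) _ = 0 at this
  rw [← Abelian.Ext.comp_assoc _ _ _ (add_zero 1) (zero_add i) (by omega), this,
    Abelian.Ext.zero_comp]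

lemma conδ_hom_surj (h : SES f g) (hs : Subsingleton (EExt R D M 1)) (k : A →ₗ[R] M) :
    ∃ l : B →ₗ[R] M, l ∘ₗ f = k := by
  obtain ⟨y, hy⟩ := con_exact₁ h 0 ((ext0 A M).symm k) (Subsingleton.elim _ _)
  obtain ⟨l, rfl⟩ := (ext0 B M).symm.surjective y
  rw [pre_ext0] at hy
  exact ⟨l, (ext0 A M).symm.injective hy⟩

lemma EExt_one_sub_con (h : SES f g) (hB : Subsingleton (EExt R B M 1))
    (hs : ∀ k : A →ₗ[R] M, ∃ l : B →ₗ[R] M, l ∘ₗ f = k) : Subsingleton (EExt R D M 1) := by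
  have (x : EExt R D M 1) : x = 0 := by
    obtain ⟨y, rfl⟩ := con_exact₃ h 0 x (Subsingleton.elim _ _)
    obtain ⟨k, rfl⟩ := (ext0 A M).symm.surjective y
    obtain ⟨l, rfl⟩ := hs k
    rw [← pre_ext0, conδ_pre]
  exact ⟨fun x y => by rw [this x, this y]⟩

variable (C I E : Type u) [AddCommGroup C] [Module R C] [AddCommGroup I] [Module R I]
  [AddCommGroup E] [Module R E]

lemma fmap_HHfunctor_injective (hs : ∀ k : A →ₗ[R] C, ∃ l : B →ₗ[R] C, l ∘ₗ f = k) :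
    Function.Injective (fmap (HHfunctor C I) f) := by
  intro (φ : (A →ₗ[R] C) →ₗ[R] I) (ψ : (A →ₗ[R] C) →ₗ[R] I) h
  refine LinearMap.ext fun k => ?_
  obtain ⟨l, rfl⟩ := hs k
  exact LinearMap.congr_fun (f := φ ∘ₗ LinearMap.lcomp R C f) (g := ψ ∘ₗ LinearMap.lcomp R C f) h l

variable [IsNoetherianRing R] [Module.Injective R I] [Module.Injective R E]

lemma ext_sub_hom_HHfunctor (i : ℕ) (Y : Type u) [AddCommGroup Y] [Module R Y] [Module.Finite R Y]
    (hY : ∀ i, Subsingleton (EExt R Y C (i + 1))) :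
    Subsingleton (EExt R Y ((HHfunctor C I).obj (.of R R) →ₗ[R] E) (i + 1)) := by
  induction i generalizing Y with
  | zero =>
    obtain ⟨m, g, hg⟩ := Module.Finite.exists_fin' R Y
    have h := SES.ker g hg
    refine EExt_one_sub_con h (EExt_projective _ _ 0) fun w => ?_
    let α := TensorProduct.lift w ∘ₗ
      (ewEquiv (HHfunctor_rightExact C I) (LinearMap.ker g)).symm.toLinearMap
    obtain ⟨β, hβ⟩ := Module.Injective.out (fmap (HHfunctor C I) (LinearMap.ker g).subtype)
      (fmap_HHfunctor_injective C I (conδ_hom_surj h (hY 0))) α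
    refine ⟨TensorProduct.curry (β ∘ₗ ewMap (HHfunctor C I) _), ?_⟩
    ext z x
    change β (ewMap _ _ ((LinearMap.ker g).subtype.rTensor _ (z ⊗ₜ x))) = w z x
    rw [ewMap_natural, hβ]
    change TensorProduct.lift w ((ewEquiv (HHfunctor_rightExact C I) (LinearMap.ker g)).symm
      (ewEquiv (HHfunctor_rightExact C I) (LinearMap.ker g) (z ⊗ₜ x))) = w z x
    rw [LinearEquiv.symm_apply_apply, TensorProduct.lift.tmul]
  | succ i ih =>
    obtain ⟨m, g, hg⟩ := Module.Finite.exists_fin' R Y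
    have h := SES.ker g hg
    exact con_sub₃ h (ih _ fun j => con_sub₁ h (EExt_projective _ _ j) (hY (j + 1)))
      (EExt_projective _ _ _)

end Acyclic

section TorZero
open TensorProduct

variable {R : Type u} [CommRing R]
variable {A B D M N : Type u} [AddCommGroup A] [Module R A] [AddCommGroup B] [Module R B]
  [AddCommGroup D] [Module R D] [AddCommGroup M] [Module R M] [AddCommGroup N] [Module R N]
  {f : A →ₗ[R] B} {g : B →ₗ[R] D}

variable (R) in
/-- Vanishing of `Tor_i(C, M)` for all `i ≥ 1`, detected by injective modules. -/
def TorZero (C M : Type u) [AddCommGroup C] [Module R C] [AddCommGroup M] [Module R M] : Prop :=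
  ∀ (E : Type u) [AddCommGroup E] [Module R E] [Module.Injective R E], ∀ i,
    Subsingleton (EExt R C (M →ₗ[R] E) (i + 1))

variable (C I : Type u) [AddCommGroup C] [Module R C] [AddCommGroup I] [Module R I]
variable {C}

lemma TorZero.congr (h : TorZero R C M) (e : M ≃ₗ[R] N) : TorZero R C N :=
  fun E _ _ _ i => EExt_sub_right (e.congrLeft E R) (h E i)

lemma lTensor_injective (h : SES f g) (hD : TorZero R C D) :
    Function.Injective (f.lTensor C) := by
  obtain ⟨E, _, _, j, _, hj⟩ := exists_injective_embedding R (C ⊗[R] A)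
  obtain ⟨l, hl⟩ := covδ_hom_surj (ses_hom_con h E) (hD E 0) (TensorProduct.curry j)
  have key : TensorProduct.lift l ∘ₗ f.lTensor C = j := by
    refine TensorProduct.ext' fun c x => ?_
    have := LinearMap.congr_fun (LinearMap.congr_fun hl c) x
    exact this
  refine Function.Injective.of_comp (f := TensorProduct.lift l) ?_
  rw [← LinearMap.coe_comp, key]
  exact hj

lemma ses_lTensor (h : SES f g) (hD : TorZero R C D) : SES (f.lTensor C) (g.lTensor C) :=
  ⟨lTensor_injective h hD, lTensor_exact C h.exact h.surj, LinearMap.lTensor_surjective C h.surj⟩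

lemma TorZero.of_ses (h : SES f g) (hB : TorZero R C B) (hD : TorZero R C D) : TorZero R C A :=
  fun E _ _ _ i => cov_sub₃ (ses_hom_con h E) (hB E i) (hD E (i + 1))

variable [IsNoetherianRing R] [Module.Injective R I] [Module.Finite R C]

/-- `Hom(Hom(R, C), I) ≃ Hom(C, I)`. -/
def HHfunctorRing (C I : Type u) [AddCommGroup C] [Module R C] [AddCommGroup I] [Module R I] :
    (HHfunctor C I).obj (.of R R) ≃ₗ[R] (C →ₗ[R] I) :=
  (LinearMap.ringLmapEquivSelf R R C).congrLeft I R

lemma torZero_hom (hC : ∀ i, Subsingleton (EExt R C C (i + 1))) : TorZero R C (C →ₗ[R] I) :=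
  fun E _ _ _ i => EExt_sub_right ((HHfunctorRing C I).congrLeft E R)
    (ext_sub_hom_HHfunctor C I E i C hC)

/-- `C ⊗ Hom(C, I) ≃ I` for semidualizing `C`. -/
def tensorHomEquiv (e : R ≃ₗ[R] (C →ₗ[R] C)) : C ⊗[R] (C →ₗ[R] I) ≃ₗ[R] I :=
  (HHfunctorRing C I).symm.lTensor C ≪≫ₗ ewEquiv (HHfunctor_rightExact C I) C ≪≫ₗ
    e.symm.congrLeft I R ≪≫ₗ LinearMap.ringLmapEquivSelf R R I

end TorZero

section Coresolutions
open TensorProduct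

variable {R : Type u} [CommRing R]

lemma hasCoresDimLE_congr {P : ModuleCat.{u} R → Prop}
    (hP : ∀ M N : ModuleCat.{u} R, (M ≃ₗ[R] N) → P M → P N) {s : ℕ} {M N : ModuleCat.{u} R}
    (e : M ≃ₗ[R] N) (h : HasCoresDimLE R P s M) : HasCoresDimLE R P s N := by
  cases s with
  | zero => exact h.imp (fun h => e.toEquiv.subsingleton_congr.1 h) (hP M N e)
  | succ s =>
    refine h.imp (fun h => e.toEquiv.subsingleton_congr.1 h) ?_
    rintro ⟨X, f, hX, hf, hs⟩
    refine ⟨X, f ∘ₗ e.symm.toLinearMap, hX, hf.comp e.symm.injective, ?_⟩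
    rwa [LinearMap.range_comp_of_range_eq_top _ e.symm.range]

lemma hasCoresDimLE_injective_iff {s : ℕ} {M : ModuleCat.{u} R} :
    HasCoresDimLE R (fun N => Module.Injective R N) s M ↔ IdLE R s M := by
  induction s generalizing M with
  | zero =>
    rw [idLE_zero_iff]
    refine ⟨?_, Or.inr⟩
    rintro (h | h)
    · exact idLE_zero_iff.1 (idLE_of_subsingleton 0)
    · exact h
  | succ s ih =>
    constructor
    · rintro (h | ⟨X, f, hX, hf, hs⟩)
      · exact idLE_of_subsingleton _
      · exact (idLE_succ_iff (SES.mkQ f hf)).2 (ih.1 hs)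
    · intro h
      obtain ⟨E, _, _, f, hE, hf⟩ := exists_injective_embedding R M
      exact Or.inr ⟨.of R E, f, hE, hf, ih.2 ((idLE_succ_iff (SES.mkQ f hf)).1 h)⟩

lemma IsCInjective.congr {C M N : ModuleCat.{u} R} (e : M ≃ₗ[R] N) (h : IsCInjective R C M) :
    IsCInjective R C N := by
  obtain ⟨I, hI, ⟨e'⟩⟩ := h
  exact ⟨I, hI, ⟨e.symm ≪≫ₗ e'⟩⟩

lemma hasCoresDimLE_hom {C : ModuleCat.{u} R} {s : ℕ} {K : Type u} [AddCommGroup K] [Module R K]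
    (hK : IdLE R s K) (hC : ∀ i, Subsingleton (EExt R C K (i + 1))) :
    HasCoresDimLE R (IsCInjective R C) s (.of R (C →ₗ[R] K)) := by
  induction s generalizing K with
  | zero => exact Or.inr ⟨.of R K, idLE_zero_iff.1 hK, ⟨LinearEquiv.refl R _⟩⟩
  | succ s ih =>
    obtain ⟨E, _, _, f, hE, hf⟩ := exists_injective_embedding R K
    have h := SES.mkQ f hf
    have h' := ses_hom_cov h C (hC 0)
    refine Or.inr ⟨.of R (C →ₗ[R] E), LinearMap.compRight R f,
      ⟨.of R E, hE, ⟨LinearEquiv.refl R _⟩⟩, h'.inj, ?_⟩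
    have hD := ih ((idLE_succ_iff h).1 hK)
      fun i => cov_sub₃ h (EExt_injective C E i) (hC (i + 1))
    exact hasCoresDimLE_congr (fun _ _ => IsCInjective.congr)
      (h'.exact.linearEquivOfSurjective h'.surj).symm hD

variable [IsNoetherianRing R]

lemma torZero_of_hasCoresDimLE {C : ModuleCat.{u} R} [Module.Finite R C]
    (hC : ∀ i, Subsingleton (EExt R C C (i + 1))) (e : R ≃ₗ[R] (C →ₗ[R] C)) {s : ℕ}
    {M : ModuleCat.{u} R} (h : HasCoresDimLE R (IsCInjective R C) s M) :
    TorZero R C M ∧ IdLE R s (C ⊗[R] M) := by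
  have hsub {s : ℕ} {M : ModuleCat.{u} R} (h : Subsingleton M) :
      TorZero R C M ∧ IdLE R s (C ⊗[R] M) :=
    ⟨fun E _ _ _ i => EExt_sub_of_sub_right _, idLE_of_subsingleton s⟩
  have hinj {M : ModuleCat.{u} R} (h : IsCInjective R C M) :
      TorZero R C M ∧ Module.Injective R (C ⊗[R] M) := by
    obtain ⟨I, hI, ⟨e'⟩⟩ := h
    exact ⟨(torZero_hom I hC).congr e'.symm,
      injective_of_equiv (e'.lTensor C ≪≫ₗ tensorHomEquiv I e)⟩
  induction s generalizing M with
  | zero =>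
    rcases h with h | h
    · exact hsub h
    · exact ⟨(hinj h).1, idLE_zero_iff.2 (hinj h).2⟩
  | succ s ih =>
    rcases h with h | ⟨X, f, hX, hf, hs⟩
    · exact hsub h
    · have h := SES.mkQ f hf
      obtain ⟨hT, hI⟩ := ih hs
      have := (hinj hX).2
      exact ⟨.of_ses h (hinj hX).1 hT, (idLE_succ_iff (ses_lTensor h hT)).2 hI⟩

lemma hasCoresDimLE_isCInjective_iff {C : ModuleCat.{u} R} [Module.Finite R C]
    (hC : ∀ i, Subsingleton (EExt R C C (i + 1))) (e : R ≃ₗ[R] (C →ₗ[R] C)) {s : ℕ}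
    {H : ModuleCat.{u} R} {K : Type u} [AddCommGroup K] [Module R K]
    (hK : ∀ i, Subsingleton (EExt R C K (i + 1))) (e₁ : H ≃ₗ[R] (C →ₗ[R] K))
    (e₂ : C ⊗[R] H ≃ₗ[R] K) :
    HasCoresDimLE R (IsCInjective R C) s H ↔ IdLE R s K :=
  ⟨fun h => (torZero_of_hasCoresDimLE hC e h).2.congr e₂,
    fun h => hasCoresDimLE_congr (M := .of R _) (fun _ _ => IsCInjective.congr) e₁.symm
      (hasCoresDimLE_hom h hK)⟩

end Coresolutions

section Artinian

variable {R : Type u} [CommRing R] {a : Ideal R}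
variable {M N : Type u} [AddCommGroup M] [Module R M] [AddCommGroup N] [Module R N]

/-- The `j`-th slice of a submodule along the powers of `x`. -/
def slice (x : R) (L : Submodule R N) (j : ℕ) :
    Submodule R (LinearMap.ker (LinearMap.lsmul R N x)) :=
  ((L.comap (LinearMap.ker (LinearMap.lsmul R N (x ^ (j + 1)))).subtype).map
    ((LinearMap.lsmul R N (x ^ j)).restrict fun z hz => by
      simpa [pow_succ, mul_smul] using hz))

lemma mem_slice {x : R} {L : Submodule R N} {j : ℕ} {w : LinearMap.ker (LinearMap.lsmul R N x)} :
    w ∈ slice x L j ↔ ∃ z ∈ L, x ^ (j + 1) • z = 0 ∧ x ^ j • z = w := by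
  constructor
  · rintro ⟨z, hz, rfl⟩
    exact ⟨z, hz, z.2, rfl⟩
  · rintro ⟨z, hz, h0, h1⟩
    exact ⟨⟨z, h0⟩, hz, Subtype.ext h1⟩

lemma slice_antitone {x : R} {L L' : Submodule R N} (h : L' ≤ L) {i j : ℕ} (hij : i ≤ j) :
    slice x L' j ≤ slice x L i := by
  intro w hw
  obtain ⟨z, hz, h0, h1⟩ := mem_slice.1 hw
  refine mem_slice.2 ⟨x ^ (j - i) • z, L.smul_mem _ (h hz), ?_, ?_⟩
  · rw [smul_smul, ← pow_add, ← h0]; congr 2; omega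
  · rw [smul_smul, ← pow_add, ← h1]; congr 2; omega

lemma eq_of_slice_eq {x : R} (hN : ∀ z : N, ∃ t : ℕ, x ^ t • z = 0) {L L' : Submodule R N}
    (h : L' ≤ L) (hs : ∀ j, slice x L' j = slice x L j) : L = L' := by
  refine le_antisymm ?_ h
  have key (t : ℕ) : ∀ z ∈ L, x ^ t • z = 0 → z ∈ L' := by
    induction t with
    | zero =>
      intro z _ h0
      rw [pow_zero, one_smul] at h0
      rw [h0]; exact L'.zero_mem
    | succ t ih =>
      intro z hz h0
      have hw : x • x ^ t • z = 0 := by rwa [smul_smul, ← pow_succ']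
      have : (⟨x ^ t • z, hw⟩ : LinearMap.ker (LinearMap.lsmul R N x)) ∈ slice x L' t := by
        rw [hs]; exact mem_slice.2 ⟨z, hz, h0, rfl⟩
      obtain ⟨z', hz', -, h1⟩ := mem_slice.1 this
      have := ih (z - z') (L.sub_mem hz (h hz')) (by rw [smul_sub, h1, sub_self])
      simpa using L'.add_mem this hz'
  exact fun z hz => (hN z).elim fun t ht => key t z hz ht

/-- A module which is torsion for the powers of `x` is Artinian as soon as the kernel of `x` is. -/
lemma isArtinian_of_ker {x : R} (hN : ∀ z : N, ∃ t : ℕ, x ^ t • z = 0)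
    [IsArtinian R (LinearMap.ker (LinearMap.lsmul R N x))] : IsArtinian R N := by
  refine monotone_stabilizes_iff_artinian.1 fun F => ?_
  let L (i : ℕ) : Submodule R N := OrderDual.ofDual (F i)
  have hL {i j : ℕ} (h : i ≤ j) : L j ≤ L i := F.monotone h
  obtain ⟨_, ⟨i₀, j₀, rfl⟩, hmin⟩ := IsArtinian.set_has_minimal
    {U | ∃ i j, U = slice x (L i) j} ⟨_, 0, 0, rfl⟩
  have hlarge {i j : ℕ} (hi : i₀ ≤ i) (hj : j₀ ≤ j) : slice x (L i) j = slice x (L i₀) j₀ :=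
    (slice_antitone (hL hi) hj).eq_of_not_lt (hmin _ ⟨i, j, rfl⟩)
  have hsmall (j : ℕ) : ∃ k, ∀ i, k ≤ i → slice x (L i) j = slice x (L k) j := by
    obtain ⟨k, hk⟩ := monotone_stabilizes_iff_artinian.2 inferInstance
      (⟨fun i => OrderDual.toDual (slice x (L i) j),
        fun i k h => slice_antitone (hL h) le_rfl⟩ : ℕ →o (Submodule R _)ᵒᵈ)
    exact ⟨k, fun i hi => (hk i hi).symm⟩
  choose k hk using hsmall
  let n := i₀ + (Finset.range j₀).sup k
  refine ⟨n, fun i hi => eq_of_slice_eq hN (hL hi) fun j => ?_⟩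
  rcases lt_or_ge j j₀ with hj | hj
  · have : k j ≤ n := (Finset.le_sup (Finset.mem_range.2 hj)).trans (Nat.le_add_left _ _)
    exact (hk j i (this.trans hi)).trans (hk j n this).symm
  · exact (hlarge ((Nat.le_add_right _ _).trans hi) hj).trans
      (hlarge (Nat.le_add_right _ _) hj).symm

variable [IsNoetherianRing R]

lemma isArtinian_of_isTors (ha : ∀ p : Ideal R, p.IsPrime → a ≤ p → p.IsMaximal)
    [Module.Finite R M] : IsTors a M → IsArtinian R M := by
  refine IsNoetherianRing.induction_on_isQuotientEquivQuotientPrime R (M := M)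
    (motive := fun M _ _ _ => IsTors a M → IsArtinian R M) inferInstance ?_ ?_ ?_
  · intro N _ _ _ _ _
    infer_instance
  · intro N _ _ _ p e h
    obtain ⟨t, ht⟩ := h (e.symm 1)
    have hp := ha p.asIdeal p.2 (p.2.le_of_pow_le fun r hr => by
      have := ht r hr
      rw [← map_smul, LinearEquiv.map_eq_zero_iff, Algebra.smul_def, mul_one] at this
      exact Ideal.Quotient.eq_zero_iff_mem.1 this)
    have : IsSimpleModule R (R ⧸ p.asIdeal) := isSimpleModule_iff_isCoatom.2 hp.out
    exact isArtinian_of_linearEquiv e.symm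
  · intro N₁ _ _ _ N₂ _ _ _ N₃ _ _ _ f g hf hg hfg h1 h3 h2
    have := h1 (h2.of_injective f hf)
    have := h3 (h2.of_surjective g hg)
    exact isArtinian_of_range_eq_ker f g hfg.linearMap_ker_eq.symm

lemma isArtinian_LC (ha : ∀ p : Ideal R, p.IsPrime → a ≤ p → p.IsMaximal) (i : ℕ) :
    ∀ (M : Type u) [AddCommGroup M] [Module R M] [Module.Finite R M], IsArtinian R (LC a i M) := by
  induction i with
  | zero =>
    intro M _ _ _
    have := isArtinian_of_isTors (M := Gam a M) ha isTors_Gam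
    exact isArtinian_of_linearEquiv (LC0 a M).symm
  | succ i ih =>
    intro M _ _ _
    have hreg := hom_sub_of_Gam (isTors_quotient (le_refl a)) (Gam_quotient (a := a) M)
    obtain ⟨x, hx, hxM⟩ := IsSMulRegular.subsingleton_linearMap_iff.1 hreg
    rw [Ideal.annihilator_quotient] at hx
    have h := SES.mkQ (x • (LinearMap.id : (M ⧸ Gam a M) →ₗ[R] M ⧸ Gam a M)) hxM
    have hker : IsArtinian R
        (LinearMap.ker (LinearMap.lsmul R (LC a (i + 1) (M ⧸ Gam a M)) x)) := by
      have := ih ((M ⧸ Gam a M) ⧸ LinearMap.range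
        (x • (LinearMap.id : (M ⧸ Gam a M) →ₗ[R] M ⧸ Gam a M)))
      refine isArtinian_of_surjective _ ((LCδ a i h).codRestrict _ fun z => ?_) fun w => ?_
      · rw [LinearMap.mem_ker, LinearMap.lsmul_apply, ← LCmap_lsmul]
        exact (LC_exact₁ a i h _).2 ⟨z, rfl⟩
      · obtain ⟨z, hz⟩ := (LC_exact₁ a i h w).1 (by rw [LCmap_lsmul]; exact w.2)
        exact ⟨z, Subtype.ext hz⟩
    have := isArtinian_of_ker (x := x) fun z : LC a (i + 1) (M ⧸ Gam a M) =>
      (LC_torsion z).imp fun t ht => ht _ (Ideal.pow_mem_pow hx t)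
    exact isArtinian_of_linearEquiv (LCmodGam a M i).symm

end Artinian

section Dimension

variable {R : Type u} [CommRing R]

lemma exists_prime_of_le_dim {I : Ideal R} {d : ℕ}
    (h : (d : WithBot ℕ∞) ≤ ringKrullDim (R ⧸ I)) :
    ∃ q : Ideal R, q.IsPrime ∧ I ≤ q ∧ (d : WithBot ℕ∞) ≤ ringKrullDim (R ⧸ q) := by
  rw [ringKrullDim_quotient, Order.le_krullDim_iff] at h
  obtain ⟨l, hl⟩ := h
  refine ⟨l.head.1.asIdeal, l.head.1.2, l.head.2, ?_⟩
  rw [ringKrullDim_quotient, Order.le_krullDim_iff]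
  exact ⟨⟨l.length, fun i => ⟨(l i).1, LTSeries.head_le l i⟩, fun i => l.step i⟩, hl⟩

open IsLocalRing

variable [IsLocalRing R]

lemma ringKrullDim_quotient_maximalIdeal : ringKrullDim (R ⧸ maximalIdeal R) = 0 :=
  ringKrullDim_eq_zero_of_field (ResidueField R)

variable [IsNoetherianRing R]

lemma exists_prime_of_dim_eq_succ {p : Ideal R} [hp : p.IsPrime] {d : ℕ}
    (hd : ringKrullDim (R ⧸ p) = (d + 1 : ℕ)) {x : R} (hxm : x ∈ maximalIdeal R) (hx : x ∉ p) :
    ∃ q : Ideal R, q.IsPrime ∧ p ⊔ Ideal.span {x} ≤ q ∧ ringKrullDim (R ⧸ q) = d := by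
  have : IsLocalRing (R ⧸ p) := .of_surjective' (Ideal.Quotient.mk p) Ideal.Quotient.mk_surjective
  have h1 := ringKrullDim_quotient_span_singleton_succ_eq_ringKrullDim_of_mem_nonZeroDivisors
    (R := R ⧸ p) (x := Ideal.Quotient.mk p x)
    (mem_nonZeroDivisors_of_ne_zero fun h => hx (Ideal.Quotient.eq_zero_iff_mem.1 h))
    (by
      rw [mem_maximalIdeal, mem_nonunits_iff]
      intro hu
      obtain ⟨y, hy⟩ := hu.exists_right_inv
      obtain ⟨y, rfl⟩ := Ideal.Quotient.mk_surjective y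
      rw [← map_mul, ← map_one (Ideal.Quotient.mk p), Ideal.Quotient.eq] at hy
      refine (Ideal.ne_top_iff_one _).1 (maximalIdeal.isMaximal R).ne_top ?_
      have := sub_mem (Ideal.mul_mem_right y _ hxm) (le_maximalIdeal hp.ne_top hy)
      rwa [sub_sub_cancel] at this)
  rw [hd, ← Set.image_singleton, ← Ideal.map_span,
    ringKrullDim_eq_of_ringEquiv (DoubleQuot.quotQuotEquivQuotSup p (Ideal.span {x}))] at h1
  push_cast at h1
  obtain ⟨q, hq, hle, hdq⟩ := exists_prime_of_le_dim
    (ENat.WithBot.add_le_add_natCast_right_iff.1 h1.ge)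
  exact ⟨q, hq, hle, le_antisymm ((ringKrullDim_quotient_anti hle).trans
    (ENat.WithBot.add_le_add_natCast_right_iff.1 h1.le)) hdq⟩

/-- A parameter modulo an ideal of positive dimension. -/
lemma exists_dim_quotient_lt {J : Ideal R} {d : ℕ} (hJ : ringKrullDim (R ⧸ J) ≤ (d + 1 : ℕ)) :
    ∃ x ∈ maximalIdeal R, ringKrullDim (R ⧸ (J ⊔ Ideal.span {x})) < (d + 1 : ℕ) := by
  have hfin := (Ideal.finite_minimalPrimes_of_isNoetherianRing R J).subset
    (Set.sdiff_subset (t := {maximalIdeal R}))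
  have hnot : ¬ (maximalIdeal R : Set R) ⊆ ⋃ q ∈ (hfin.toFinset : Set (Ideal R)), (q : Set R) := by
    rw [Ideal.subset_union_prime ⊤ ⊤ fun q hq _ _ => (hfin.mem_toFinset.1 hq).1.1.1]
    rintro ⟨q, hq, hle⟩
    have hq := hfin.mem_toFinset.1 hq
    exact hq.2 ((maximalIdeal.isMaximal R).eq_of_le hq.1.1.1.ne_top hle).symm
  obtain ⟨x, hxm, hx⟩ := Set.not_subset.1 hnot
  refine ⟨x, hxm, not_le.1 fun hle => ?_⟩
  obtain ⟨q, hq, hJq, hdq⟩ := exists_prime_of_le_dim hle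
  obtain ⟨q', hq', hle'⟩ := Ideal.exists_minimalPrimes_le (le_sup_left.trans hJq)
  by_cases hm : q' = maximalIdeal R
  · subst hm
    rw [← (maximalIdeal.isMaximal R).eq_of_le hq.ne_top hle',
      ringKrullDim_quotient_maximalIdeal] at hdq
    norm_cast at hdq
  · have hxq' : x ∉ q' := fun h => hx (Set.mem_biUnion (hfin.mem_toFinset.2 ⟨hq', hm⟩) h)
    have h1 := ringKrullDim_quotient_sup_succ_le hq'.1.1 hxq'
    have h2 : q' ⊔ Ideal.span {x} ≤ q := sup_le hle' (le_sup_right.trans hJq)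
    have h3 := (hdq.trans (ringKrullDim_quotient_anti h2))
    exact (ENat.WithBot.add_one_le_natCast_iff.1
      ((h1.trans (ringKrullDim_quotient_anti hq'.1.2)).trans hJ)).not_ge h3

end Dimension

section Nonvanishing

lemma smul_quotient_eq_zero {R : Type u} [CommRing R] {I : Ideal R} {r : R} (hr : r ∈ I)
    (m : R ⧸ I) :
    r • m = 0 := by
  have h : r ∈ Module.annihilator R (R ⧸ I) := by rwa [Ideal.annihilator_quotient]
  exact Module.mem_annihilator.1 h m

variable {R : Type u} [CommRing R] [IsNoetherianRing R] {a : Ideal R}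

lemma LC_quotient_prime_sub {I q : Ideal R} {d : ℕ} (hI : ringKrullDim (R ⧸ I) < (d + 1 : ℕ))
    (h : I ≤ q) (hs : Subsingleton (LC a d (R ⧸ I))) : Subsingleton (LC a d (R ⧸ q)) := by
  refine LC_sub₃ a (SES.ker (Submodule.factor h) (Submodule.factor_surjective h)) hs
    (LC_sub_of_killed (I := I) (fun r hr m => Subtype.ext (smul_quotient_eq_zero hr m.1)) hI)

lemma LC_quotient_smul_surjective {J : Ideal R} {d : ℕ} {x : R}
    (hJ : ringKrullDim (R ⧸ J) < (d + 1 : ℕ)) (hx : ringKrullDim (R ⧸ (J ⊔ Ideal.span {x})) < d)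
    (z : LC a d (R ⧸ J)) : ∃ w, x • w = z := by
  let f := x • (LinearMap.id : (R ⧸ J) →ₗ[R] (R ⧸ J))
  have h1 : Subsingleton (LC a (d + 1) (LinearMap.ker f.rangeRestrict)) :=
    LC_sub_of_killed (I := J) (fun r hr m => Subtype.ext (smul_quotient_eq_zero hr m.1)) hJ
  have h2 : Subsingleton (LC a d ((R ⧸ J) ⧸ LinearMap.range f)) := by
    refine LC_sub_of_killed (I := J ⊔ Ideal.span {x}) (fun r hr m => ?_) hx
    obtain ⟨m, rfl⟩ := Submodule.Quotient.mk_surjective _ m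
    obtain ⟨j, hj, s, hs, rfl⟩ := Submodule.mem_sup.1 hr
    obtain ⟨s, rfl⟩ := Ideal.mem_span_singleton'.1 hs
    rw [← Submodule.Quotient.mk_smul, Submodule.Quotient.mk_eq_zero, add_smul,
      smul_quotient_eq_zero hj, zero_add, mul_comm, mul_smul]
    exact ⟨s • m, rfl⟩
  obtain ⟨v, rfl⟩ := (LC_exact₂ a d (SES.submodule (LinearMap.range f)) z).1 (Subsingleton.elim _ _)
  obtain ⟨w, rfl⟩ := (LC_exact₃ a d (SES.ker f.rangeRestrict f.surjective_rangeRestrict) v).1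
    (Subsingleton.elim _ _)
  refine ⟨w, ?_⟩
  rw [← LCmap_comp, ← LCmap_lsmul]
  rfl

open IsLocalRing

lemma not_subsingleton_LC_of_prime [IsLocalRing R] (ham : a ≤ maximalIdeal R)
    (ha : ∀ p : Ideal R, p.IsPrime → a ≤ p → p.IsMaximal) (d : ℕ) :
    ∀ p : Ideal R, p.IsPrime → ringKrullDim (R ⧸ p) = d → ¬ Subsingleton (LC a d (R ⧸ p)) := by
  induction d with
  | zero =>
    intro p hp hd hs
    have hpm : p = maximalIdeal R := by
      by_contra hpm
      obtain ⟨x, hxm, hxp⟩ := SetLike.exists_of_lt ((le_maximalIdeal hp.ne_top).lt_of_ne hpm)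
      have h1 := ringKrullDim_quotient_sup_succ_le hp hxp
      have : Nontrivial (R ⧸ (p ⊔ Ideal.span {x})) := Ideal.Quotient.nontrivial_iff.2
        (ne_top_of_le_ne_top (maximalIdeal.isMaximal R).ne_top
          (sup_le (le_maximalIdeal hp.ne_top) ((Ideal.span_singleton_le_iff_mem _).2 hxm)))
      rw [hd] at h1
      exact (ENat.WithBot.add_one_le_natCast_iff.1 h1).not_ge ringKrullDim_nonneg_of_nontrivial
    have htop := isTors_iff.1 (isTors_quotient (ham.trans hpm.ge))
    have : Nontrivial (R ⧸ p) := Ideal.Quotient.nontrivial_iff.2 hp.ne_top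
    rw [LC_zero_sub, htop] at hs
    exact top_ne_bot hs
  | succ d ih =>
    intro p hp hd hs
    have hpm : p ≠ maximalIdeal R := by
      rintro rfl
      rw [ringKrullDim_quotient_maximalIdeal] at hd
      norm_cast at hd
    have hdim {y : R} (hy : y ∉ p) : ringKrullDim (R ⧸ (p ⊔ Ideal.span {y})) < (d + 1 : ℕ) :=
      ENat.WithBot.add_one_le_natCast_iff.1 ((ringKrullDim_quotient_sup_succ_le hp hy).trans_eq hd)
    have hnot {x : R} (hxm : x ∈ maximalIdeal R) (hx : x ∉ p)
        (hsurj : ∀ z : LC a d (R ⧸ p), ∃ w, x • w = z) : False := by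
      obtain ⟨q, hq, hle, hdq⟩ := exists_prime_of_dim_eq_succ hd hxm hx
      refine ih q hq hdq (LC_quotient_prime_sub (hdim hx) hle ?_)
      obtain ⟨g, h⟩ := exists_ses_smul p x fun r hr => (hp.mem_or_mem hr).resolve_right hx
      refine subsingleton_of_forall_eq 0 fun z => ?_
      obtain ⟨z, rfl⟩ := (LC_exact₃ a d h z).1 (Subsingleton.elim _ _)
      obtain ⟨w, rfl⟩ := hsurj z
      exact (LC_exact₂ a d h _).2 ⟨w, LCmap_lsmul x w⟩
    obtain ⟨y₀, hy₀m, hy₀⟩ := SetLike.exists_of_lt ((le_maximalIdeal hp.ne_top).lt_of_ne hpm)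
    cases d with
    | zero =>
      have : Subsingleton (LC a 0 (R ⧸ p)) := by
        rw [LC_zero_sub, eq_bot_iff]
        rintro m ⟨t, ht⟩
        obtain ⟨m, rfl⟩ := Ideal.Quotient.mk_surjective m
        rw [Submodule.mem_bot, Ideal.Quotient.eq_zero_iff_mem]
        by_contra hm
        have hle : a ^ t ≤ p := fun r hr => by
          have := Ideal.Quotient.eq_zero_iff_mem.1 (ht r hr)
          exact (hp.mem_or_mem this).resolve_right hm
        exact hpm (eq_maximalIdeal (ha p hp (hp.le_of_pow_le hle)))
      exact hnot hy₀m hy₀ fun z => ⟨0, Subsingleton.elim _ _⟩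
    | succ d =>
      have := isArtinian_LC ha (d + 1) (R ⧸ p)
      obtain ⟨_, ⟨y, ⟨hym, hy⟩, rfl⟩, hmin⟩ := IsArtinian.set_has_minimal
        ((fun y => LinearMap.range (LinearMap.lsmul R (LC a (d + 1) (R ⧸ p)) y)) ''
          {y | y ∈ maximalIdeal R ∧ y ∉ p}) ⟨_, y₀, ⟨hy₀m, hy₀⟩, rfl⟩
      obtain ⟨g, h⟩ := exists_ses_smul p y fun r hr => (hp.mem_or_mem hr).resolve_right hy
      have hlt := hdim hy
      obtain ⟨x, hxm, hxdim⟩ := exists_dim_quotient_lt (J := p ⊔ Ideal.span {y}) (d := d) (by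
        have h1 := (ringKrullDim_quotient_sup_succ_le hp hy).trans_eq hd
        rw [Nat.cast_add_one (d + 1)] at h1
        exact (ENat.WithBot.add_le_add_natCast_right_iff (c := 1)).1 (by exact_mod_cast h1))
      have hsum (z : LC a (d + 1) (R ⧸ p)) : ∃ v w, z = x • v + y • w := by
        obtain ⟨v, hv⟩ := LC_quotient_smul_surjective (a := a) hlt hxdim (LCmap a (d + 1) g z)
        obtain ⟨v, rfl⟩ := (LC_exact₃ a (d + 1) h v).1 (Subsingleton.elim _ _)
        obtain ⟨w, hw⟩ := (LC_exact₂ a (d + 1) h (z - x • v)).1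
          (by rw [map_sub, map_smul, hv, sub_self])
        rw [LCmap_lsmul] at hw
        exact ⟨v, w, by rw [hw, add_sub_cancel]⟩
      have hxp : x ∉ p := by
        intro hx
        refine hnot hym hy fun z => ?_
        obtain ⟨v, w, rfl⟩ := hsum z
        refine ⟨w, ?_⟩
        rw [← LCmap_lsmul x v, show x • (LinearMap.id : (R ⧸ p) →ₗ[R] (R ⧸ p)) =
          (0 : R) • LinearMap.id
          from LinearMap.ext fun m => by
            rw [zero_smul]; exact smul_quotient_eq_zero hx m, LCmap_lsmul, zero_smul, zero_add]
      have heq : LinearMap.range (LinearMap.lsmul R (LC a (d + 1) (R ⧸ p)) (x * y)) =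
          LinearMap.range (LinearMap.lsmul R (LC a (d + 1) (R ⧸ p)) y) := by
        refine LE.le.eq_of_not_lt ?_ (hmin _ ⟨x * y, ⟨Ideal.mul_mem_left _ _ hym,
          fun h => (hp.mem_or_mem h).elim hxp hy⟩, rfl⟩)
        rintro _ ⟨w, rfl⟩
        exact ⟨x • w, by simp [smul_smul, mul_comm]⟩
      refine hnot hxm hxp fun z => ?_
      obtain ⟨v, w, rfl⟩ := hsum z
      obtain ⟨w', hw'⟩ :
          y • w ∈ LinearMap.range (LinearMap.lsmul R (LC a (d + 1) (R ⧸ p)) (x * y)) :=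
        heq ▸ ⟨w, rfl⟩
      refine ⟨v + y • w', ?_⟩
      rw [smul_add, ← hw', LinearMap.lsmul_apply, mul_smul]

/-- Grothendieck's nonvanishing theorem. -/
lemma not_subsingleton_LC [IsLocalRing R] (ham : a ≤ maximalIdeal R)
    (ha : ∀ p : Ideal R, p.IsPrime → a ≤ p → p.IsMaximal) {d : ℕ} (hd : ringKrullDim R = d) :
    ¬ Subsingleton (LC a d R) := by
  intro hs
  obtain ⟨p, hp, -, hdp⟩ := exists_prime_of_le_dim (I := (⊥ : Ideal R)) (d := d)
    (by rw [ringKrullDim_eq_of_ringEquiv (RingEquiv.quotientBot R), hd])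
  have hle := ringKrullDim_quotient_le (R := R) p
  refine not_subsingleton_LC_of_prime ham ha d p hp (le_antisymm (hle.trans hd.le) hdp) ?_
  refine LC_sub₃ a (SES.submodule p) hs (LC_sub_of_finite ?_)
  rw [hd]
  exact_mod_cast Nat.lt_succ_self d

end Nonvanishing

section Localization

variable {R : Type u} [CommRing R] (W : Submonoid R) {A B D : Type u} [AddCommGroup A] [Module R A]
  [AddCommGroup B] [Module R B] [AddCommGroup D] [Module R D] {f : A →ₗ[R] B} {g : B →ₗ[R] D}

lemma SES.localized (h : SES f g) : SES (LocalizedModule.map W f) (LocalizedModule.map W g) :=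
  ⟨LocalizedModule.map_injective W f h.inj, LocalizedModule.map_exact W f g h.exact,
    LocalizedModule.map_surjective W g h.surj⟩

lemma mk_mem_Gam {a : Ideal R} {m : D} (hm : m ∈ Gam a D) (s : W) :
    LocalizedModule.mk m s ∈ Gam (a.map (algebraMap R (Localization W))) (LocalizedModule W D) := by
  obtain ⟨t, ht⟩ := hm
  refine ⟨t, fun r hr => ?_⟩
  rw [← Ideal.map_pow] at hr
  induction hr using Submodule.span_induction with
  | mem r hr =>
    obtain ⟨r, hr, rfl⟩ := hr
    rw [algebraMap_smul, LocalizedModule.smul'_mk, ht r hr, LocalizedModule.zero_mk]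
  | zero => rw [zero_smul]
  | add x y _ _ hx hy => rw [add_smul, hx, hy, add_zero]
  | smul r x _ hx => rw [smul_assoc, hx, smul_zero]

variable [IsNoetherianRing R]

lemma exists_smul_eq_zero_of_fg {I : Ideal R} {m : D}
    (h : ∀ r ∈ I, ∃ w ∈ W, w • r • m = 0) : ∃ w ∈ W, ∀ r ∈ I, w • r • m = 0 := by
  classical
  obtain ⟨S, rfl⟩ := IsNoetherian.noetherian I
  choose! w hw h using h
  refine ⟨∏ r ∈ S, w r, Submonoid.prod_mem _ fun r hr => hw r (Ideal.subset_span hr),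
    fun r hr => ?_⟩
  induction hr using Submodule.span_induction with
  | mem r hr =>
    rw [← Finset.prod_erase_mul S w hr, mul_smul, h r (Ideal.subset_span hr), smul_zero]
  | zero => rw [zero_smul, smul_zero]
  | add x y _ _ hx hy => rw [add_smul, smul_add, hx, hy, add_zero]
  | smul r x _ hx => rw [smul_assoc, smul_comm, hx, smul_zero]

lemma exists_mk_of_mem_Gam {a : Ideal R} {y : LocalizedModule W D}
    (hy : y ∈ Gam (a.map (algebraMap R (Localization W))) (LocalizedModule W D)) :
    ∃ m ∈ Gam a D, ∃ s, y = LocalizedModule.mk m s := by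
  induction y using LocalizedModule.induction_on with | h m s => ?_
  obtain ⟨t, ht⟩ := hy
  obtain ⟨w, hw, h⟩ := exists_smul_eq_zero_of_fg W (I := a ^ t) (m := m) fun r hr => by
    have := ht (algebraMap R _ r) (by
      rw [← Ideal.map_pow]
      exact Ideal.mem_map_of_mem _ hr)
    rw [algebraMap_smul, LocalizedModule.smul'_mk, ← LocalizedModule.zero_mk s,
      LocalizedModule.mk_eq] at this
    obtain ⟨v, hv⟩ := this
    refine ⟨v * s, W.mul_mem v.2 s.2, ?_⟩
    rw [mul_smul]
    simpa [Submonoid.smul_def] using hv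
  refine ⟨w • m, ⟨t, fun r hr => by rw [smul_comm]; exact h r hr⟩, ⟨w, hw⟩ * s, ?_⟩
  rw [LocalizedModule.mk_eq]
  refine ⟨1, congrArg _ ?_⟩
  rw [mul_comm, mul_smul]
  rfl

lemma LC_localized_sub {a : Ideal R} (i : ℕ) :
    ∀ (M : Type u) [AddCommGroup M] [Module R M], Subsingleton (LC a i M) →
      Subsingleton (LC (a.map (algebraMap R (Localization W))) i (LocalizedModule W M)) := by
  induction i with
  | zero =>
    intro M _ _ h
    rw [LC_zero_sub, eq_bot_iff] at h ⊢
    intro y hy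
    obtain ⟨m, hm, s, rfl⟩ := exists_mk_of_mem_Gam W hy
    rw [(Submodule.mem_bot R).1 (h hm), LocalizedModule.zero_mk]
    exact Submodule.zero_mem _
  | succ i ih =>
    intro M _ _ h
    obtain ⟨E, _, _, f, hE, hf⟩ := exists_injective_embedding R M
    have hs := SES.mkQ f hf
    have : Module.Injective (Localization W) (LocalizedModule W E) :=
      Module.injective_of_isLocalizedModule W (LocalizedModule.mkLinearMap W E)
    cases i with
    | zero =>
      refine LC_one_sub (hs.localized W) (LC_injective _ _ 0) fun y => ?_
      obtain ⟨m, hm, s, hy⟩ := exists_mk_of_mem_Gam W y.2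
      obtain ⟨e, he⟩ := Gam_map_surjective hs h ⟨m, hm⟩
      refine ⟨⟨LocalizedModule.mk e.1 s, mk_mem_Gam W e.2 s⟩, Subtype.ext ?_⟩
      rw [Gam.map_coe, LocalizedModule.map_mk, hy, ← Gam.map_coe, he]
    | succ i =>
      exact LC_sub₁ _ (hs.localized W)
        (ih _ (LC_sub₃ a hs (LC_injective a E i) h)) (LC_injective _ _ _)

lemma LC_localization_sub {a : Ideal R} {i : ℕ} (h : Subsingleton (LC a i R)) :
    Subsingleton (LC (a.map (algebraMap R (Localization W))) i (Localization W)) :=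
  LC_congr_sub _ ((IsLocalizedModule.iso W (Algebra.linearMap R
    (Localization W))).extendScalarsOfIsLocalization W (Localization W)) (LC_localized_sub W i R h)

end Localization

section Height

lemma ringKrullDim_quotient_annihilator_localized {R : Type u} [CommRing R] (p : Ideal R)
    [p.IsPrime] :
    ringKrullDim (Localization.AtPrime p ⧸
      Module.annihilator (Localization.AtPrime p) (LocalizedModule p.primeCompl R)) = p.height := by
  rw [((IsLocalizedModule.iso p.primeCompl (Algebra.linearMap R
    (Localization.AtPrime p))).extendScalarsOfIsLocalization p.primeCompl
      (Localization.AtPrime p)).annihilator_eq, Module.annihilator_eq_bot.2 inferInstance,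
    ringKrullDim_eq_of_ringEquiv (RingEquiv.quotientBot _),
    IsLocalization.AtPrime.ringKrullDim_eq_height p]

variable {R : Type u} [CommRing R] [IsNoetherianRing R] {a : Ideal R}

open IsLocalRing

/-- Local cohomology does not vanish at the height of a minimal prime. -/
lemma not_subsingleton_LC_height (p : Ideal R) [p.IsPrime] (hap : a ≤ p)
    (hmin : ∀ q : Ideal R, q.IsPrime → a ≤ q → q ≤ p → q = p) {n : ℕ} (hn : p.height = n) :
    ¬ Subsingleton (LC a n R) := by
  intro h
  refine not_subsingleton_LC (R := Localization.AtPrime p) ?_ (fun q hq haq => ?_) ?_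
    (LC_localization_sub p.primeCompl h)
  · rw [← Localization.AtPrime.map_eq_maximalIdeal]
    exact Ideal.map_mono hap
  · have h1 := hmin (q.under R) inferInstance (Ideal.map_le_iff_le_comap.1 haq)
      ((Ideal.comap_mono (le_maximalIdeal hq.ne_top)).trans
        (Localization.AtPrime.under_maximalIdeal (I := p)).le)
    have h2 : q = maximalIdeal (Localization.AtPrime p) := by
      refine (IsLocalization.map_under p.primeCompl _ q).symm.trans ?_
      rw [h1, Localization.AtPrime.map_eq_maximalIdeal]
    rw [h2]
    infer_instance
  · rw [IsLocalization.AtPrime.ringKrullDim_eq_height p, hn]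
    rfl

lemma not_subsingleton_LC_of_heightWRT {n : ℕ} (h : heightWRT R a R = ((n : ℕ∞) : WithBot ℕ∞)) :
    ¬ Subsingleton (LC a n R) := by
  have hsupp (p : PrimeSpectrum R) :
      p ∈ Module.support R (R ⧸ (a • (⊤ : Submodule R R))) ↔ a ≤ p.asIdeal := by
    rw [smul_eq_mul, Ideal.mul_top, Module.support_eq_zeroLocus, Ideal.annihilator_quotient]
    rfl
  simp only [heightWRT, hsupp, moduleKrullDim, ringKrullDim_quotient_annihilator_localized] at h
  have hge (q : PrimeSpectrum R) (hq : a ≤ q.asIdeal) : (n : ℕ∞) ≤ q.asIdeal.height := by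
    have := h.symm.le.trans (iInf₂_le q hq)
    exact WithBot.coe_le_coe.1 this
  obtain ⟨p, hap, hp⟩ : ∃ p : PrimeSpectrum R, a ≤ p.asIdeal ∧ p.asIdeal.height = n := by
    by_contra! hne
    have : ((n + 1 : ℕ) : WithBot ℕ∞) ≤ ((n : ℕ∞) : WithBot ℕ∞) := by
      rw [← h]
      refine le_iInf₂ fun p hp => ?_
      have := Order.add_one_le_of_lt ((hge p hp).lt_of_ne (hne p hp).symm)
      exact_mod_cast this
    norm_cast at this
    omega
  refine not_subsingleton_LC_height p.asIdeal hap (fun q hq haq hqp => ?_) hp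
  by_contra hne
  have h1 := Ideal.height_add_one_le_of_lt_of_isPrime (hqp.lt_of_ne hne)
  have h2 := (add_le_add_left (hge ⟨q, hq⟩ haq) 1).trans (h1.trans hp.le)
  norm_cast at h2
  omega

end Height

section Semidualizing
open TensorProduct

variable {R : Type u} [CommRing R]

lemma sInf_natCast_eq_tsub {P Q : ℕ → Prop} {n : ℕ} (hPQ : ∀ s, Q (n + s) ↔ P s)
    (hQ : ∀ s, Q s → n ≤ s) :
    sInf {d : ℕ∞ | ∃ m : ℕ, d = m ∧ P m} = sInf {d : ℕ∞ | ∃ m : ℕ, d = m ∧ Q m} - (n : ℕ∞) := by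
  refine le_antisymm ?_ (le_sInf ?_)
  · rcases Set.eq_empty_or_nonempty {d : ℕ∞ | ∃ m : ℕ, d = m ∧ Q m} with h | h
    · rw [h, sInf_empty, ENat.top_sub_natCast]
      exact le_top
    · obtain ⟨m, hm, hQm⟩ := csInf_mem h
      obtain ⟨s, rfl⟩ := Nat.exists_eq_add_of_le (hQ m hQm)
      rw [hm, Nat.cast_add, (ENat.addLECancellable_natCast n).add_tsub_cancel_left]
      exact sInf_le ⟨s, rfl, (hPQ s).1 hQm⟩
  · rintro _ ⟨m, rfl, hm⟩
    rw [tsub_le_iff_left]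
    exact sInf_le ⟨n + m, by push_cast; rfl, (hPQ m).2 hm⟩

lemma ext_sub_of_isSemidualizing {C : ModuleCat.{u} R} (hC : IsSemidualizing R C) (i : ℕ) :
    Subsingleton (EExt R C C (i + 1)) :=
  have := hC.2.2 (i + 1) (Nat.le_add_left 1 i)
  (oldExtEquiv C C (i + 1)).symm.toEquiv.subsingleton

lemma le_maximalIdeal_of_LC [IsLocalRing R] {a : Ideal R} {n : ℕ} (h : ¬ Subsingleton (LC a n R)) :
    a ≤ IsLocalRing.maximalIdeal R := by
  refine IsLocalRing.le_maximalIdeal fun ha => h ?_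
  subst ha
  refine subsingleton_of_forall_eq 0 fun z => ?_
  obtain ⟨t, ht⟩ := isTors_LC (a := (⊤ : Ideal R)) n z
  simpa using ht 1 (by rw [Ideal.top_pow]; trivial)

variable [IsNoetherianRing R] {a : Ideal R} {n : ℕ}

lemma isRelativeCMAt_LC (h : IsRelativeCM R a (.of R R))
    (hht : heightWRT R a R = ((n : ℕ∞) : WithBot ℕ∞)) (j : ℕ) (hj : j ≠ n) :
    Subsingleton (LC a j R) := by
  obtain ⟨m, -, hm⟩ := h
  have hn := not_subsingleton_LC_of_heightWRT hht
  rw [(lcEquiv a n R).symm.toEquiv.subsingleton_congr, not_subsingleton_iff_nontrivial] at hn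
  rw [(lcEquiv a j R).symm.toEquiv.subsingleton_congr]
  by_contra hne
  rw [not_subsingleton_iff_nontrivial] at hne
  exact hj ((hm j hne).trans (hm n hn).symm)

theorem injDim_sub_eq [IsLocalRing R] {C : ModuleCat.{u} R} (hC : IsSemidualizing R C)
    (hR : ∀ j, j ≠ n → Subsingleton (LC a j R)) (hne : ¬ Subsingleton (LC a n R)) :
    cinjDim R C ((localCohomology a n).obj (.of R R)) = injDim R C - (n : ℕ∞) ∧
      injDim R C - (n : ℕ∞) = injDim R ((localCohomology a n).obj C) := by
  have hfin : Module.Finite R C := hC.1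
  obtain ⟨d, hd⟩ : ∃ d : ℕ, ringKrullDim R ≤ d :=
    ⟨_, (Order.krullDim_eq_length_of_finiteDimensionalOrder (α := PrimeSpectrum R)).le⟩
  have hup (M : Type u) [AddCommGroup M] [Module R M] [Module.Finite R M] {i : ℕ} (hi : n < i) :
      Subsingleton (LC a i M) := LC_sub_of_ring hd (fun i hi => hR i hi.ne') hi
  let e : R ≃ₗ[R] (C →ₗ[R] C) := LinearEquiv.ofBijective (LinearMap.lsmul R C) hC.2.1
  have hann : Module.annihilator R C = ⊥ := by
    rw [eq_bot_iff]
    intro r hr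
    exact e.injective ((LinearMap.ext fun x => Module.mem_annihilator.1 hr x).trans e.map_zero.symm)
  obtain ⟨hCa, ⟨e₁⟩, hK⟩ := Concentrated.main hann n C
    { ext := ext_sub_of_isSemidualizing hC
      hom := fun i hi => LC_congr_sub a e (hR i hi)
      up := fun i hi => hup C hi }
  have e₂ : C ⊗[R] LC a n R ≃ₗ[R] LC a n C :=
    ewEquiv (LCfunctor_rightExact fun M => hup M n.lt_succ_self) C
  have hKne : Nontrivial (LC a n C) := by
    rw [← not_subsingleton_iff_nontrivial]
    intro h
    exact hne ((LCcongr a n e).trans e₁).toEquiv.subsingleton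
  have hiff (s : ℕ) : IdLE R (n + s) C ↔ IdLE R s (LC a n C) :=
    ⟨idLE_LC hCa, idLE_of_LC (le_maximalIdeal_of_LC hne) hCa⟩
  have hdim := sInf_natCast_eq_tsub hiff fun s hs => le_of_idLE hCa hs hKne
  have h1 : injDim R C = sInf {d : ℕ∞ | ∃ m : ℕ, d = m ∧ IdLE R m C} := by
    simp only [injDim, coresDim, hasCoresDimLE_injective_iff]
  have h2 : injDim R ((localCohomology a n).obj C) =
      sInf {d : ℕ∞ | ∃ m : ℕ, d = m ∧ IdLE R m (LC a n C)} := by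
    have h (s : ℕ) : IdLE R s ((localCohomology a n).obj C) ↔ IdLE R s (LC a n C) :=
      ⟨fun h => h.congr (lcEquiv a n C), fun h => h.congr (lcEquiv a n C).symm⟩
    simp only [injDim, coresDim, hasCoresDimLE_injective_iff, h]
  have h3 : cinjDim R C ((localCohomology a n).obj (.of R R)) =
      sInf {d : ℕ∞ | ∃ m : ℕ, d = m ∧ IdLE R m (LC a n C)} := by
    have h (s : ℕ) := hasCoresDimLE_isCInjective_iff (s := s) (ext_sub_of_isSemidualizing hC) e hK
      ((lcEquiv a n R).trans ((LCcongr a n e).trans e₁))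
      ((LinearEquiv.lTensor C (lcEquiv a n R)).trans e₂)
    simp only [cinjDim, coresDim, h]
  rw [h1, h2, h3]
  exact ⟨hdim, hdim.symm⟩

end Semidualizing

end LocCoh
end

noncomputable section
open CategoryTheory TensorProduct

/-- If `R` is relative Cohen-Macaulay with respect to `a` with
`ht_R(a) = n`, then `C` is dualizing iff `C-id_R H_a^n(R)` is finite, and moreover
`C-id_R H_a^n(R) = id_R C - n = id_R H_a^n(C)`. -/
theorem stmt_7 (R : Type u) [CommRing R] [IsNoetherianRing R] [IsLocalRing R]
    (C : ModuleCat.{u} R) (hC : IsSemidualizing R C)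
    (a : Ideal R) (n : ℕ)
    (hRCM : IsRelativeCM R a (ModuleCat.of R R))
    (hht : heightWRT R a R = ((n : ℕ∞) : WithBot ℕ∞)) :
    (IsDualizing R C ↔
      cinjDim R C ((localCohomology a n).obj (ModuleCat.of R R)) ≠ ⊤) ∧
    cinjDim R C ((localCohomology a n).obj (ModuleCat.of R R)) = injDim R C - (n : ℕ∞) ∧
    injDim R C - (n : ℕ∞) = injDim R ((localCohomology a n).obj C) := by
  have h := LocCoh.injDim_sub_eq hC (LocCoh.isRelativeCMAt_LC hRCM hht)
    (LocCoh.not_subsingleton_LC_of_heightWRT hht)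
  refine ⟨?_, h⟩
  rw [h.1, IsDualizing, and_iff_right hC, not_iff_not, ENat.sub_eq_top_iff]
  simp

end
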